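/- arXiv:0801.1483 — 2 statements merged into one kernel-verified Lean document; each statement's English description precedes it below -/
import Mathlib

section
/- Let F be a fullerene graph containing a ring R of five faces (consecutive faces sharing exactly one edge, shared edges forming a matching), with inner cycle C and outer cycle C'. Then either C or C' bounds a face of F, or both C and C' have length 10 and all five faces of R are hexagons. -/
open SimpleGraph

/-- The set of vertices incident with some edge of a face boundary. -/
def faceVerts (f : Finset (Sym2 V)) : Set V := {v | ∃ e ∈ f, v ∈ e}

/-- `G` has a perfect matching. -/
def HasPM (G : SimpleGraph V) : Prop := ∃ M : G.Subgraph, M.IsPerfectMatching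

/-- Number of odd connected components of `G`. -/
noncomputable def oddComponents (G : SimpleGraph V) : ℕ :=
  Nat.card {c : G.ConnectedComponent // Odd (Nat.card c.supp)}

/-- `G` is cyclically `k`-edge-connected: no set of fewer than `k` edges
separates `G` into two parts each containing a cycle. -/
def CycEdgeConn (G : SimpleGraph V) (k : ℕ) : Prop :=
  ∀ D : Finset (Sym2 V), D.card < k →
    ¬ ∃ A : Set V, (∀ a ∈ A, ∀ b ∉ A, ¬ (G.deleteEdges (↑D : Set (Sym2 V))).Adj a b) ∧
      ¬ (G.induce A).IsAcyclic ∧ ¬ (G.induce Aᶜ).IsAcyclic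

/-- A combinatorial fullerene: a cubic, 3-connected plane graph presented together with
its face boundaries (as edge sets of boundary cycles), every face a pentagon or a
hexagon, each edge on exactly two faces, Euler's formula, and exactly 12 pentagons. -/
structure IsFullerene [Fintype V] [DecidableEq V] (G : SimpleGraph V)
    (faces : Finset (Finset (Sym2 V))) : Prop where
  cubic : ∀ v : V, (G.neighborSet v).ncard = 3
  card_ge : 4 ≤ Fintype.card V
  threeConnected : ∀ s : Set V, s.ncard ≤ 2 → (G.induce sᶜ).Connected
  face_cycle : ∀ f ∈ faces, ∃ (v : V) (c : G.Walk v v), c.IsCycle ∧ c.edges.toFinset = f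
  face_size : ∀ f ∈ faces, f.card = 5 ∨ f.card = 6
  edge_two_faces : ∀ e ∈ G.edgeSet, (faces.filter (fun f => e ∈ f)).card = 2
  euler : Fintype.card V + faces.card = G.edgeSet.ncard + 2
  pentagons : (faces.filter (fun f => f.card = 5)).card = 12
/-- A polygonal ring of length `l` of faces: a cyclic sequence of faces, consecutive
faces sharing exactly one edge, non-consecutive faces vertex-disjoint, and the
shared edges forming a matching. -/
def IsFaceRing [DecidableEq V] (faces : Finset (Finset (Sym2 V)))
    (l : ℕ) (ring : ZMod l → Finset (Sym2 V)) : Prop :=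
  3 ≤ l ∧ Function.Injective ring ∧
  (∀ i, ring i ∈ faces) ∧
  (∀ i, ∃ e, ring i ∩ ring (i + 1) = {e}) ∧
  (∀ i j : ZMod l, j ≠ i → j ≠ i + 1 → j ≠ i - 1 →
    Disjoint (faceVerts (ring i)) (faceVerts (ring j))) ∧
  (∀ i j : ZMod l, i ≠ j → ∀ e ∈ ring i ∩ ring (i + 1), ∀ e' ∈ ring j ∩ ring (j + 1),
    ∀ v : V, v ∈ e → v ∉ e')

/-- `c` and `c'` are the two boundary cycles (inner and outer cycle) of the ring:
they are disjoint cycles covering all vertices of the ring, and their edges are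
exactly the edges lying on exactly one face of the ring. -/
def AreBoundaryCycles [DecidableEq V] {G : SimpleGraph V} {u w : V} (l : ℕ)
    (ring : ZMod l → Finset (Sym2 V)) (c : G.Walk u u) (c' : G.Walk w w) : Prop :=
  c.IsCycle ∧ c'.IsCycle ∧
  (∀ x ∈ c.support, x ∉ c'.support) ∧
  (∀ x : V, (x ∈ c.support ∨ x ∈ c'.support) ↔ ∃ i, x ∈ faceVerts (ring i)) ∧
  (∀ e : Sym2 V, (e ∈ c.edges ∨ e ∈ c'.edges) ↔ (∃! i : ZMod l, e ∈ ring i))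

namespace FaceRing
open Finset

variable {V : Type*} [Fintype V] [DecidableEq V]

open Classical in
/-- The edges of `H` with both ends in `S`. -/
noncomputable def inside (H : Finset (Sym2 V)) (S : Finset V) : Finset (Sym2 V) :=
  {e ∈ H | ∀ v ∈ e, v ∈ S}

open Classical in
/-- The edges of `H` with one end in `S` and one end outside `S`. -/
noncomputable def cut (H : Finset (Sym2 V)) (S : Finset V) : Finset (Sym2 V) :=
  {e ∈ H | (∃ v ∈ e, v ∈ S) ∧ ∃ v ∈ e, v ∉ S}

/-- The graph with vertex set `S` and edge set `H` is connected, expressed through cuts. -/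
def CutConnected (H : Finset (Sym2 V)) (S : Finset V) : Prop :=
  ∀ A ⊆ S, A.Nonempty → A ≠ S → ∃ e ∈ H, (∃ v ∈ e, v ∈ A) ∧ ∃ v ∈ e, v ∈ S \ A

/-- A cubic plane map, given by its edge set `E` and the set `F` of its face boundaries: every
face has five or six edges, and every edge cut has at least three edges. -/
structure IsCubicMap (E : Finset (Sym2 V)) (F : Finset (Finset (Sym2 V))) : Prop where
  not_isDiag : ∀ e ∈ E, ¬ e.IsDiag
  card_incident : ∀ v : V, #{e ∈ E | v ∈ e} = 3
  face_subset : ∀ f ∈ F, f ⊆ E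
  card_faces : ∀ e ∈ E, #{f ∈ F | e ∈ f} = 2
  face_degree : ∀ f ∈ F, ∀ v : V, #{e ∈ f | v ∈ e} = 0 ∨ #{e ∈ f | v ∈ e} = 2
  face_split : ∀ f ∈ F, ∀ S : Finset V, Disjoint f (cut E S) →
    f ⊆ inside E S ∨ f ⊆ inside E Sᶜ
  five_le : ∀ f ∈ F, 5 ≤ #f
  le_six : ∀ f ∈ F, #f ≤ 6
  euler : Fintype.card V + #F = #E + 2
  three_le_cut : ∀ S : Finset V, S.Nonempty → Sᶜ.Nonempty → 3 ≤ #(cut E S)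

section Cuts

variable {H : Finset (Sym2 V)} {S : Finset V} {e : Sym2 V}

theorem mem_inside : e ∈ inside H S ↔ e ∈ H ∧ ∀ v ∈ e, v ∈ S := by simp [inside]

theorem mem_cut : e ∈ cut H S ↔ e ∈ H ∧ (∃ v ∈ e, v ∈ S) ∧ ∃ v ∈ e, v ∉ S := by simp [cut]

theorem inside_subset : inside H S ⊆ H := fun _ he => (mem_inside.1 he).1

theorem cut_subset : cut H S ⊆ H := fun _ he => (mem_cut.1 he).1

theorem cut_compl (H : Finset (Sym2 V)) (S : Finset V) : cut H Sᶜ = cut H S := by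
  ext e
  simp only [mem_cut, mem_compl, not_not]
  tauto

theorem mem_inside_or_mem_cut {v : V} (he : e ∈ H) (hv : v ∈ e) (hS : v ∈ S) :
    e ∈ inside H S ∨ e ∈ cut H S := by
  simp only [mem_inside, mem_cut]
  by_cases h : ∀ v ∈ e, v ∈ S
  · exact Or.inl ⟨he, h⟩
  · push Not at h
    exact Or.inr ⟨he, ⟨v, hv, hS⟩, h⟩

theorem disjoint_inside_cut : Disjoint (inside H S) (cut H S) := by
  rw [Finset.disjoint_left]
  intro e h h'
  obtain ⟨-, -, v, hv, hvS⟩ := mem_cut.1 h'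
  exact hvS ((mem_inside.1 h).2 v hv)

theorem exists_mem_sym2 {α : Type*} (e : Sym2 α) : ∃ v, v ∈ e := by
  induction e with | _ a b => exact ⟨a, by simp⟩

theorem disjoint_inside_inside {A B : Finset V} (h : Disjoint A B) :
    Disjoint (inside H A) (inside H B) := by
  rw [Finset.disjoint_left]
  intro e h₁ h₂
  obtain ⟨v, hv⟩ := exists_mem_sym2 e
  exact Finset.disjoint_left.1 h ((mem_inside.1 h₁).2 v hv) ((mem_inside.1 h₂).2 v hv)

theorem sum_card_incident (hH : ∀ e ∈ H, ¬ e.IsDiag) (S : Finset V) :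
    ∑ v ∈ S, #{e ∈ H | v ∈ e} = 2 * #(inside H S) + #(cut H S) := by
  classical
  have h := Finset.sum_card_bipartiteAbove_eq_sum_card_bipartiteBelow (s := S) (t := H)
    (fun v e => v ∈ e)
  simp only [bipartiteAbove, bipartiteBelow] at h
  rw [h, inside, cut, card_filter, card_filter, mul_sum, ← sum_add_distrib]
  refine sum_congr rfl fun e he => ?_
  have hd := hH e he
  induction e with | _ a b =>
  have hab : a ≠ b := by simpa using hd
  have : ({v ∈ S | v ∈ s(a, b)} : Finset V) = S ∩ {a, b} := by
    ext v; simp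
  rw [this]
  by_cases ha : a ∈ S <;> by_cases hb : b ∈ S <;>
    simp [ha, hb, hab]

theorem card_eq_inside_add_inside_add_cut (H : Finset (Sym2 V)) (S : Finset V) :
    #H = #(inside H S) + #(inside H Sᶜ) + #(cut H S) := by
  classical
  rw [← card_union_of_disjoint (disjoint_inside_inside disjoint_compl_right),
    ← card_union_of_disjoint]
  · congr 1
    ext e
    simp only [mem_union, mem_inside, mem_cut, mem_compl]
    constructor
    · intro he
      by_cases h₁ : ∀ v ∈ e, v ∈ S
      · exact Or.inl (Or.inl ⟨he, h₁⟩)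
      · by_cases h₂ : ∀ v ∈ e, v ∉ S
        · exact Or.inl (Or.inr ⟨he, h₂⟩)
        · push Not at h₁ h₂
          exact Or.inr ⟨he, h₂, h₁⟩
    · tauto
  · rw [disjoint_union_left]
    refine ⟨disjoint_inside_cut, ?_⟩
    rw [← cut_compl]
    exact disjoint_inside_cut

end Cuts

section Rank

variable {E : Finset (Sym2 V)} {F : Finset (Finset (Sym2 V))}

theorem IsCubicMap.exists_face (h : IsCubicMap E F) {e : Sym2 V} (he : e ∈ E) :
    ∃ f ∈ F, e ∈ f := by
  have : ({f ∈ F | e ∈ f} : Finset _).Nonempty := by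
    rw [← card_pos, h.card_faces e he]; norm_num
  obtain ⟨f, hf⟩ := this
  exact ⟨f, (mem_filter.1 hf).1, (mem_filter.1 hf).2⟩

theorem IsCubicMap.exists_ne_of_mem_face (h : IsCubicMap E F) {f : Finset (Sym2 V)} (hf : f ∈ F)
    {e : Sym2 V} (he : e ∈ f) {v : V} (hv : v ∈ e) : ∃ e' ∈ f, v ∈ e' ∧ e' ≠ e := by
  have h1 : e ∈ ({e ∈ f | v ∈ e} : Finset _) := mem_filter.2 ⟨he, hv⟩
  have h2 : 1 < #{e ∈ f | v ∈ e} := by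
    rcases h.face_degree f hf v with h0 | h0
    · rw [card_eq_zero] at h0; simp [h0] at h1
    · omega
  obtain ⟨e', he', hne⟩ := exists_mem_ne h2 e
  exact ⟨e', (mem_filter.1 he').1, (mem_filter.1 he').2, hne⟩

/-- Two edges at a vertex lie on a common face. -/
theorem IsCubicMap.exists_common_face (h : IsCubicMap E F) {v : V} {e₁ e₂ : Sym2 V}
    (he₁ : e₁ ∈ E) (he₂ : e₂ ∈ E) (hv₁ : v ∈ e₁) (hv₂ : v ∈ e₂) (hne : e₁ ≠ e₂) :
    ∃ f ∈ F, e₁ ∈ f ∧ e₂ ∈ f := by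
  by_contra! hno
  obtain ⟨e₃, hE₃⟩ : ∃ e₃, ∀ e ∈ E, v ∈ e → e = e₁ ∨ e = e₂ ∨ e = e₃ := by
    have hc := h.card_incident v
    have hsub : ({e₁, e₂} : Finset _) ⊆ {e ∈ E | v ∈ e} := by
      intro e he
      simp only [mem_insert, mem_singleton] at he
      rcases he with rfl | rfl <;> simp [*]
    have hd := card_sdiff_add_card_eq_card hsub
    rw [hc, card_pair hne] at hd
    obtain ⟨e₃, h₃⟩ := card_eq_one.1 (show #(({e ∈ E | v ∈ e} : Finset _) \ {e₁, e₂}) = 1 by omega)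
    refine ⟨e₃, fun e he hv => ?_⟩
    by_contra! hc
    have : e ∈ (({e ∈ E | v ∈ e} : Finset _) \ {e₁, e₂}) := by simp [he, hv, hc]
    rw [h₃] at this
    exact hc.2.2 (by simpa using this)
  have key₁ : ({f ∈ F | e₁ ∈ f} : Finset _) ⊆ {f ∈ F | e₃ ∈ f} := by
    intro f hf
    rw [mem_filter] at hf
    obtain ⟨e', he', hv', hne'⟩ := h.exists_ne_of_mem_face hf.1 hf.2 hv₁
    rcases hE₃ e' (h.face_subset f hf.1 he') hv' with rfl | rfl | rfl
    · exact absurd rfl hne'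
    · exact absurd he' (hno f hf.1 hf.2)
    · exact mem_filter.2 ⟨hf.1, he'⟩
  have key₂ : ({f ∈ F | e₂ ∈ f} : Finset _) ⊆ {f ∈ F | e₃ ∈ f} := by
    intro f hf
    rw [mem_filter] at hf
    obtain ⟨e', he', hv', hne'⟩ := h.exists_ne_of_mem_face hf.1 hf.2 hv₂
    rcases hE₃ e' (h.face_subset f hf.1 he') hv' with rfl | rfl | rfl
    · exact absurd hf.2 (hno f hf.1 he')
    · exact absurd rfl hne'
    · exact mem_filter.2 ⟨hf.1, he'⟩
  obtain ⟨f, hf, hef⟩ := h.exists_face he₁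
  obtain ⟨e', he', hv', hne'⟩ := h.exists_ne_of_mem_face hf hef hv₁
  have hE' := h.face_subset f hf he'
  have he₃ : e₃ ∈ E := by
    rcases hE₃ e' hE' hv' with rfl | rfl | rfl
    · exact absurd rfl hne'
    · exact absurd he' (hno f hf hef)
    · exact hE'
  have e1 := eq_of_subset_of_card_le key₁ (by rw [h.card_faces _ he₁, h.card_faces _ he₃])
  have e2 := eq_of_subset_of_card_le key₂ (by rw [h.card_faces _ he₂, h.card_faces _ he₃])
  have hf1 : f ∈ ({f ∈ F | e₁ ∈ f} : Finset _) := mem_filter.2 ⟨hf, hef⟩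
  rw [e1, ← e2] at hf1
  exact hno f hf hef (mem_filter.1 hf1).2

/-- The dual of a cubic map is connected. -/
theorem IsCubicMap.eq_of_closed (h : IsCubicMap E F) {A : Finset (Finset (Sym2 V))}
    (hA : A ⊆ F) (hne : A.Nonempty)
    (hcl : ∀ f ∈ A, ∀ g ∈ F, ∀ e ∈ f, e ∈ g → g ∈ A) : A = F := by
  classical
  have face_nonempty : ∀ f ∈ F, ∃ v, ∃ e ∈ f, v ∈ e := by
    intro f hf
    have : f.Nonempty := card_pos.1 (by have := h.five_le f hf; omega)
    obtain ⟨e, he⟩ := this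
    obtain ⟨v, hv⟩ := exists_mem_sym2 e
    exact ⟨v, e, he, hv⟩
  set S : Finset V := {v | ∃ f ∈ A, ∃ e ∈ f, v ∈ e} with hS
  have loc : ∀ v ∈ S, ∀ g ∈ F, ∀ e ∈ g, v ∈ e → g ∈ A := by
    intro v hv g hg e' he' hv'
    simp only [hS, mem_filter, mem_univ, true_and] at hv
    obtain ⟨f, hf, e, he, hve⟩ := hv
    by_cases hee : e = e'
    · subst hee; exact hcl f hf g hg e he he'
    · obtain ⟨k, hk, hek, hek'⟩ := h.exists_common_face (h.face_subset f (hA hf) he)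
        (h.face_subset g hg he') hve hv' hee
      exact hcl k (hcl f hf k hk e he hek) g hg e' hek' he'
  have hSne : S.Nonempty := by
    obtain ⟨f, hf⟩ := hne
    obtain ⟨v, e, he, hv⟩ := face_nonempty f (hA hf)
    exact ⟨v, by simp only [hS, mem_filter, mem_univ, true_and]; exact ⟨f, hf, e, he, hv⟩⟩
  have hcut : cut E S = ∅ := by
    rw [eq_empty_iff_forall_notMem]
    intro e he
    obtain ⟨heE, ⟨a, hae, haS⟩, b, hbe, hbS⟩ := mem_cut.1 he
    obtain ⟨g, hg, heg⟩ := h.exists_face heE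
    apply hbS
    simp only [hS, mem_filter, mem_univ, true_and]
    exact ⟨g, loc a haS g hg e heg hae, e, heg, hbe⟩
  have hall : ∀ v, v ∈ S := by
    by_contra! hc
    obtain ⟨v, hv⟩ := hc
    have := h.three_le_cut S hSne ⟨v, by simpa using hv⟩
    simp [hcut] at this
  refine hA.antisymm fun g hg => ?_
  obtain ⟨v, e, he, hv⟩ := face_nonempty g hg
  exact loc v (hall v) g hg e he hv

theorem finrank_ker_le_one {S : Finset V} {H : Finset (Sym2 V)} (hH : inside H S = H)
    (hnd : ∀ e ∈ H, ¬ e.IsDiag) (hconn : CutConnected H S) :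
    Module.finrank (ZMod 2) (LinearMap.ker
      (Matrix.of fun (e : H) (v : S) => if v.1 ∈ e.1 then (1 : ZMod 2) else 0).mulVecLin) ≤ 1 := by
  classical
  apply finrank_le_one (⟨fun _ => 1, ?_⟩ : LinearMap.ker
      (Matrix.of fun (e : H) (v : S) => if v.1 ∈ e.1 then (1 : ZMod 2) else 0).mulVecLin)
  · rintro ⟨z, hz⟩
    have hedge : ∀ e ∈ H, ∀ a b : S, a.1 ∈ e → b.1 ∈ e → z a = z b := by
      intro e he a b ha hb
      by_cases hab : a = b
      · rw [hab]
      have hab' : a.1 ≠ b.1 := fun h => hab (Subtype.ext h)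
      have h0 := congrFun (LinearMap.mem_ker.1 hz) ⟨e, he⟩
      have hee : e = s(a.1, b.1) := (Sym2.mem_and_mem_iff hab').1 ⟨ha, hb⟩
      simp only [Matrix.mulVecLin_apply, Matrix.mulVec, dotProduct, Matrix.of_apply,
        Pi.zero_apply] at h0
      rw [← sum_subset (subset_univ {a, b}), sum_pair hab] at h0
      · simp only [ha, hb, if_true, one_mul] at h0
        exact CharTwo.add_eq_zero.1 h0
      · intro x _ hx
        rw [if_neg, zero_mul]
        intro hxe
        rw [hee, Sym2.mem_iff] at hxe
        rcases hxe with hxe | hxe <;> exact hx (by simp [Subtype.ext hxe])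
    by_cases hS : ∃ a : S, True
    · obtain ⟨a, -⟩ := hS
      refine ⟨z a, Subtype.ext (funext fun b => ?_)⟩
      simp only [Submodule.coe_smul, Pi.smul_apply, smul_eq_mul, mul_one]
      by_contra hne
      obtain ⟨e, he, ⟨v, hve, hv⟩, w, hwe, hw⟩ := hconn {v ∈ S | ∃ h : v ∈ S, z ⟨v, h⟩ = z a}
        (filter_subset _ _) ⟨a, by simp⟩ (by
          intro h
          have : b.1 ∈ ({v ∈ S | ∃ h : v ∈ S, z ⟨v, h⟩ = z a} : Finset V) := by
            rw [h]; exact b.2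
          simp only [mem_filter] at this
          exact hne this.2.2.symm)
      simp only [mem_filter, mem_sdiff] at hv hw
      obtain ⟨-, hvS, hv⟩ := hv
      exact hw.2 ⟨hw.1, hw.1, (hedge e he ⟨w, hw.1⟩ ⟨v, hvS⟩ hwe hve).trans hv⟩
    · exact ⟨0, Subtype.ext (funext fun b => (hS ⟨b, trivial⟩).elim)⟩
  · rw [LinearMap.mem_ker]
    funext ⟨e, he⟩
    simp only [Matrix.mulVecLin_apply, Matrix.mulVec, dotProduct, Matrix.of_apply,
      Pi.zero_apply, mul_one]
    have heS := (mem_inside.1 (hH.symm ▸ he)).2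
    have hd := hnd e he
    induction e with | _ a b =>
    have hab : a ≠ b := by simpa using hd
    have ha := heS a (by simp)
    have hb := heS b (by simp)
    have hab' : (⟨a, ha⟩ : S) ≠ ⟨b, hb⟩ := fun h => hab (congrArg Subtype.val h)
    rw [← sum_subset (subset_univ {⟨a, ha⟩, ⟨b, hb⟩}), sum_pair hab']
    · simp [CharTwo.add_self_eq_zero]
    · intro x _ hx
      rw [if_neg]
      intro hxe
      rw [Sym2.mem_iff] at hxe
      rcases hxe with hxe | hxe <;> simp [Subtype.ext_iff, hxe] at hx

/-- The planarity inequality: the faces inside a connected proper subgraph are independent in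
its cycle space. -/
theorem IsCubicMap.card_faces_add_card_le (h : IsCubicMap E F) {S : Finset V}
    {H : Finset (Sym2 V)} (hHE : H ⊆ E) (hH : inside H S = H) (hconn : CutConnected H S)
    (hne : {f ∈ F | f ⊆ H} ≠ F) : #{f ∈ F | f ⊆ H} + #S ≤ #H + 1 := by
  classical
  set A : Finset (Finset (Sym2 V)) := {f ∈ F | f ⊆ H} with hA
  let M : Matrix H S (ZMod 2) := Matrix.of fun e v => if v.1 ∈ e.1 then (1 : ZMod 2) else 0
  let N : Matrix H A (ZMod 2) := Matrix.of fun e f => if e.1 ∈ f.1 then (1 : ZMod 2) else 0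
  have hMN : M.transpose * N = 0 := by
    ext v f
    have hf := mem_filter.1 f.2
    simp only [M, N, Matrix.mul_apply, Matrix.transpose_apply, Matrix.of_apply, Matrix.zero_apply]
    rw [← attach_eq_univ, sum_attach H
      (fun e => (if v.1 ∈ e then (1 : ZMod 2) else 0) * if e ∈ f.1 then 1 else 0)]
    have : ∑ e ∈ H, (if v.1 ∈ e then (1 : ZMod 2) else 0) * (if e ∈ f.1 then 1 else 0)
        = (#{e ∈ f.1 | v.1 ∈ e} : ℕ) := by
      rw [card_filter, Nat.cast_sum, ← sum_subset hf.2]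
      · refine sum_congr rfl fun e he => ?_
        simp [he]
      · intro e _ he
        simp [he]
    rw [this]
    rcases h.face_degree f.1 hf.1 v.1 with h0 | h0 <;> rw [h0]
    · rfl
    · decide
  have hrank := Matrix.rank_add_rank_le_card_of_mul_eq_zero hMN
  have hM : #S ≤ M.transpose.rank + 1 := by
    rw [Matrix.rank_transpose]
    have h1 := M.mulVecLin.finrank_range_add_finrank_ker
    have h2 : Module.finrank (ZMod 2) (LinearMap.ker M.mulVecLin) ≤ 1 :=
      finrank_ker_le_one hH (fun e he => h.not_isDiag e (hHE he)) hconn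
    rw [Module.finrank_fintype_fun_eq_card, Fintype.card_coe] at h1
    change M.rank + _ = _ at h1
    omega
  have hN : N.rank = #A := by
    have hker : LinearMap.ker N.mulVecLin = ⊥ := by
      rw [LinearMap.ker_eq_bot']
      intro y hy
      by_contra hy0
      obtain ⟨f₀, hf₀⟩ := Function.ne_iff.1 hy0
      apply hne
      have hB : ({f ∈ A | ∃ hf : f ∈ A, y ⟨f, hf⟩ ≠ 0} : Finset _) = F := by
        refine h.eq_of_closed ((filter_subset _ _).trans (filter_subset _ _))
          ⟨f₀.1, by simpa using hf₀⟩ ?_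
        intro f hf g hg e hef heg
        simp only [mem_filter] at hf ⊢
        obtain ⟨hfA, _, hyf⟩ := hf
        have hf' := mem_filter.1 hfA
        by_contra hcon
        have hfg : f ≠ g := by
          rintro rfl
          exact hcon ⟨hfA, hfA, hyf⟩
        have heH := hf'.2 hef
        have h0 := congrFun hy ⟨e, heH⟩
        simp only [N, Matrix.mulVecLin_apply, Matrix.mulVec, dotProduct, Matrix.of_apply,
          Pi.zero_apply] at h0
        have htwo : ∀ k ∈ F, e ∈ k → k = f ∨ k = g := by
          intro k hk hek
          have hs : ({f, g} : Finset _) ⊆ {f ∈ F | e ∈ f} := by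
            intro x hx
            simp only [mem_insert, mem_singleton] at hx
            rcases hx with rfl | rfl
            · exact mem_filter.2 ⟨hf'.1, hef⟩
            · exact mem_filter.2 ⟨hg, heg⟩
          have he := eq_of_subset_of_card_le hs
            (by rw [h.card_faces e (hHE heH), card_pair hfg])
          have : k ∈ ({f, g} : Finset _) := by rw [he]; exact mem_filter.2 ⟨hk, hek⟩
          simpa using this
        rw [sum_eq_single (⟨f, hfA⟩ : A)] at h0
        · simp only [hef, if_true, one_mul] at h0
          exact hyf h0
        · rintro ⟨k, hk⟩ - hkf
          by_cases hek : e ∈ k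
          · rcases htwo k (mem_filter.1 hk).1 hek with rfl | rfl
            · exact absurd rfl hkf
            · by_cases hy : y ⟨k, hk⟩ = 0
              · rw [hy, mul_zero]
              · exact absurd ⟨hk, hk, hy⟩ hcon
          · simp [hek]
        · simp
      exact (filter_subset _ _).antisymm (hB.symm.subset.trans (filter_subset _ _))
    have h1 := N.mulVecLin.finrank_range_add_finrank_ker
    rw [hker, finrank_bot, Module.finrank_fintype_fun_eq_card, Fintype.card_coe] at h1
    exact h1
  rw [Fintype.card_coe] at hrank
  omega

end Rank

section Bond

variable {E : Finset (Sym2 V)} {F : Finset (Finset (Sym2 V))} {S : Finset V}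

open Classical in
/-- The faces having an edge in the cut of `S`. -/
noncomputable def crossing (E : Finset (Sym2 V)) (F : Finset (Finset (Sym2 V))) (S : Finset V) :
    Finset (Finset (Sym2 V)) :=
  {f ∈ F | ∃ e ∈ f, e ∈ cut E S}

open Classical in
/-- The edges inside `S` lying on a crossing face. -/
noncomputable def rim (E : Finset (Sym2 V)) (F : Finset (Finset (Sym2 V))) (S : Finset V) :
    Finset (Sym2 V) :=
  {e ∈ inside E S | ∃ f ∈ crossing E F S, e ∈ f}

theorem mem_crossing {f : Finset (Sym2 V)} :
    f ∈ crossing E F S ↔ f ∈ F ∧ ∃ e ∈ f, e ∈ cut E S := by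
  simp [crossing]

theorem mem_rim {e : Sym2 V} :
    e ∈ rim E F S ↔ e ∈ inside E S ∧ ∃ f ∈ crossing E F S, e ∈ f := by
  simp [rim]

theorem crossing_compl (E : Finset (Sym2 V)) (F : Finset (Finset (Sym2 V))) (S : Finset V) :
    crossing E F Sᶜ = crossing E F S := by
  simp only [crossing, cut_compl]

theorem IsCubicMap.three_mul_card (h : IsCubicMap E F) (S : Finset V) :
    3 * #S = 2 * #(inside E S) + #(cut E S) := by
  rw [← sum_card_incident h.not_isDiag, sum_congr rfl fun v _ => h.card_incident v]
  simp [mul_comm]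

/-- A face crosses a cut an even number of times. -/
theorem IsCubicMap.even_card_cut_face (h : IsCubicMap E F) {f : Finset (Sym2 V)} (hf : f ∈ F)
    (S : Finset V) : Even #(cut f S) := by
  have h1 := sum_card_incident (fun e he => h.not_isDiag e (h.face_subset f hf he)) S (H := f)
  have h2 : Even (∑ v ∈ S, #{e ∈ f | v ∈ e}) := by
    refine even_sum _ fun v _ => ?_
    rcases h.face_degree f hf v with h0 | h0 <;> rw [h0]
    · exact Even.zero
    · exact even_two
  rw [h1] at h2
  exact (Nat.even_add.1 h2).1 (even_two_mul _)

theorem IsCubicMap.mem_cut_face (h : IsCubicMap E F) {f : Finset (Sym2 V)} (hf : f ∈ F)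
    {e : Sym2 V} : e ∈ cut f S ↔ e ∈ f ∧ e ∈ cut E S := by
  simp only [mem_cut]
  exact ⟨fun ⟨h1, h2⟩ => ⟨h1, h.face_subset f hf h1, h2⟩, fun ⟨h1, _, h2⟩ => ⟨h1, h2⟩⟩

theorem IsCubicMap.card_crossing_le (h : IsCubicMap E F) (S : Finset V) :
    #(crossing E F S) ≤ #(cut E S) := by
  classical
  have h1 := sum_card_bipartiteAbove_eq_sum_card_bipartiteBelow (s := cut E S) (t := F)
    (fun e f => e ∈ f)
  simp only [bipartiteAbove, bipartiteBelow] at h1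
  rw [sum_congr rfl fun e he => h.card_faces e (cut_subset he)] at h1
  have h2 : ∑ f ∈ crossing E F S, 2 ≤ ∑ f ∈ F, #{e ∈ cut E S | e ∈ f} := by
    refine (sum_le_sum fun f hf => ?_).trans
      (sum_le_sum_of_subset (fun f hf => (mem_crossing.1 hf).1))
    obtain ⟨hfF, e, hef, hec⟩ := mem_crossing.1 hf
    have heq : ({e ∈ cut E S | e ∈ f} : Finset _) = cut f S := by
      ext e
      rw [h.mem_cut_face hfF, mem_filter, and_comm]
    rw [heq]
    have hpos : 0 < #(cut f S) := card_pos.2 ⟨e, (h.mem_cut_face hfF).2 ⟨hef, hec⟩⟩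
    obtain ⟨k, hk⟩ := h.even_card_cut_face hfF S
    omega
  rw [← h1] at h2
  simp only [sum_const, smul_eq_mul] at h2
  omega

theorem inside_inside (E : Finset (Sym2 V)) (S : Finset V) :
    inside (inside E S) S = inside E S := by
  ext e
  simp only [mem_inside]
  tauto

theorem IsCubicMap.faces_inside_ne (h : IsCubicMap E F) (hS : S.Nonempty) (hSc : Sᶜ.Nonempty)
    {H : Finset (Sym2 V)} (hH : H ⊆ inside E S) : {f ∈ F | f ⊆ H} ≠ F := by
  intro heq
  have hpos : 0 < #(cut E S) := by have := h.three_le_cut S hS hSc; omega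
  obtain ⟨e, he⟩ := card_pos.1 hpos
  obtain ⟨f, hf, hef⟩ := h.exists_face (cut_subset he)
  rw [← heq, mem_filter] at hf
  exact Finset.disjoint_left.1 disjoint_inside_cut (hH (hf.2 hef)) he

/-- The two sides of `S` are nonempty and connected. -/
structure IsBond (E : Finset (Sym2 V)) (S : Finset V) : Prop where
  nonempty : S.Nonempty
  compl_nonempty : Sᶜ.Nonempty
  conn : CutConnected (inside E S) S
  compl_conn : CutConnected (inside E Sᶜ) Sᶜ

theorem IsBond.compl (hb : IsBond E S) : IsBond E Sᶜ where
  nonempty := hb.compl_nonempty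
  compl_nonempty := by rw [compl_compl]; exact hb.nonempty
  conn := hb.compl_conn
  compl_conn := by rw [compl_compl]; exact hb.conn

theorem IsCubicMap.bond_counts (h : IsCubicMap E F) (hb : IsBond E S) :
    #(crossing E F S) = #(cut E S) ∧ #{f ∈ F | f ⊆ inside E S} + #S = #(inside E S) + 1 := by
  classical
  have h1 := h.card_faces_add_card_le inside_subset (inside_inside E S) hb.conn
    (h.faces_inside_ne hb.nonempty hb.compl_nonempty subset_rfl)
  have h2 := h.card_faces_add_card_le inside_subset (inside_inside E Sᶜ) hb.compl_conn
    (h.faces_inside_ne hb.compl.nonempty hb.compl.compl_nonempty subset_rfl)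
  have h3 := h.card_crossing_le S
  have h4 : #F ≤ #{f ∈ F | f ⊆ inside E S} + #{f ∈ F | f ⊆ inside E Sᶜ} + #(crossing E F S) := by
    refine (card_le_card ?_).trans ((card_union_le _ _).trans
      (Nat.add_le_add_right (card_union_le _ _) _))
    intro f hf
    simp only [mem_union, mem_filter, mem_crossing]
    by_cases hc : ∃ e ∈ f, e ∈ cut E S
    · exact Or.inr ⟨hf, hc⟩
    · push Not at hc
      rcases h.face_split f hf S (Finset.disjoint_left.2 hc) with h5 | h5
      · exact Or.inl (Or.inl ⟨hf, h5⟩)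
      · exact Or.inl (Or.inr ⟨hf, h5⟩)
  have h5 := card_eq_inside_add_inside_add_cut E S
  have h6 := h.euler
  have h7 := card_add_card_compl S
  omega

/-- At most one cut edge at each vertex of `S`, and at most one crossing face at each edge
inside `S`. -/
structure IsThinSide (E : Finset (Sym2 V)) (F : Finset (Finset (Sym2 V))) (S : Finset V) :
    Prop where
  cut_unique : ∀ v ∈ S, ∀ e ∈ cut E S, ∀ e' ∈ cut E S, v ∈ e → v ∈ e' → e = e'
  face_unique : ∀ e ∈ inside E S, ∀ f ∈ crossing E F S, ∀ g ∈ crossing E F S,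
    e ∈ f → e ∈ g → f = g

theorem IsCubicMap.card_rim_le (h : IsCubicMap E F) (hb : IsBond E S) :
    10 + 2 * #(rim E F S) ≤ #S + 3 * #(cut E S) := by
  classical
  obtain ⟨-, h1⟩ := h.bond_counts hb
  have h2 := h.three_mul_card S
  have h3 := sum_card_bipartiteAbove_eq_sum_card_bipartiteBelow (s := inside E S)
    (t := {f ∈ F | f ⊆ inside E S}) (fun e f => e ∈ f)
  simp only [bipartiteAbove, bipartiteBelow] at h3
  have h4 : 5 * #{f ∈ F | f ⊆ inside E S} ≤
      ∑ f ∈ F with f ⊆ inside E S, #{e ∈ inside E S | e ∈ f} := by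
    rw [mul_comm, ← smul_eq_mul]
    refine card_nsmul_le_sum _ _ _ fun f hf => ?_
    rw [mem_filter] at hf
    refine (h.five_le f hf.1).trans (card_le_card fun e he => mem_filter.2 ⟨hf.2 he, he⟩)
  have h5 : ∑ e ∈ inside E S, (#{f ∈ {f ∈ F | f ⊆ inside E S} | e ∈ f} +
      if e ∈ rim E F S then 1 else 0) ≤ ∑ e ∈ inside E S, 2 := by
    refine sum_le_sum fun e he => ?_
    rw [← h.card_faces e (inside_subset he)]
    split_ifs with hr
    · obtain ⟨-, g, hg, heg⟩ := mem_rim.1 hr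
      obtain ⟨hgF, e', heg', hec'⟩ := mem_crossing.1 hg
      rw [Nat.succ_le_iff]
      refine card_lt_card ⟨fun f hf => ?_, fun hsub => ?_⟩
      · simp only [mem_filter] at hf ⊢
        exact ⟨hf.1.1, hf.2⟩
      · have := hsub (mem_filter.2 ⟨hgF, heg⟩)
        simp only [mem_filter] at this
        exact Finset.disjoint_left.1 disjoint_inside_cut (this.1.2 heg') hec'
    · refine card_le_card fun f hf => ?_
      simp only [mem_filter] at hf ⊢
      exact ⟨hf.1.1, hf.2⟩
  rw [sum_add_distrib, sum_const, smul_eq_mul, sum_ite_mem,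
    inter_eq_right.2 (fun e he => (mem_rim.1 he).1), sum_const, smul_eq_mul] at h5
  omega

theorem IsCubicMap.sum_card_crossing (h : IsCubicMap E F) (ht : IsThinSide E F S)
    (ht' : IsThinSide E F Sᶜ) :
    ∑ f ∈ crossing E F S, #f = #(rim E F S) + #(rim E F Sᶜ) + 2 * #(cut E S) := by
  classical
  have h1 := sum_card_bipartiteAbove_eq_sum_card_bipartiteBelow (s := E)
    (t := crossing E F S) (fun e f => e ∈ f)
  simp only [bipartiteAbove, bipartiteBelow] at h1
  have hX : ∀ f ∈ crossing E F S, f ∈ F := fun f hf => (mem_crossing.1 hf).1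
  have h2 : ∑ f ∈ crossing E F S, #f = ∑ f ∈ crossing E F S, #{e ∈ E | e ∈ f} := by
    refine sum_congr rfl fun f hf => ?_
    congr 1
    ext e
    simpa using fun he => h.face_subset f (hX f hf) he
  have one : ∀ A : Finset V, IsThinSide E F A → ∀ e ∈ rim E F A,
      #{f ∈ crossing E F A | e ∈ f} = 1 := by
    intro A hA e he
    obtain ⟨heS, f, hf, hef⟩ := mem_rim.1 he
    refine card_eq_one.2 ⟨f, eq_singleton_iff_unique_mem.2 ⟨mem_filter.2 ⟨hf, hef⟩, ?_⟩⟩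
    intro g hg
    rw [mem_filter] at hg
    exact hA.face_unique e heS g hg.1 f hf hg.2 hef
  rw [h2, ← h1]
  have h3 : ∀ e ∈ E, #{f ∈ crossing E F S | e ∈ f} =
      (if e ∈ rim E F S then 1 else 0) + (if e ∈ rim E F Sᶜ then 1 else 0) +
        2 * if e ∈ cut E S then 1 else 0 := by
    intro e he
    by_cases hc : e ∈ cut E S
    · have n1 : e ∉ rim E F S := fun hr =>
        Finset.disjoint_left.1 disjoint_inside_cut (mem_rim.1 hr).1 hc
      have n2 : e ∉ rim E F Sᶜ := fun hr =>
        Finset.disjoint_left.1 disjoint_inside_cut (mem_rim.1 hr).1 (by rwa [cut_compl])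
      have heq : ({f ∈ crossing E F S | e ∈ f} : Finset _) = {f ∈ F | e ∈ f} := by
        ext f
        simp only [mem_filter, mem_crossing]
        exact ⟨fun hf => ⟨hf.1.1, hf.2⟩, fun hf => ⟨⟨hf.1, e, hf.2, hc⟩, hf.2⟩⟩
      simp [n1, n2, hc, heq, h.card_faces e he]
    · by_cases h1 : e ∈ rim E F S
      · have n2 : e ∉ rim E F Sᶜ := fun hr =>
          Finset.disjoint_left.1 (disjoint_inside_inside disjoint_compl_right)
            (mem_rim.1 h1).1 (mem_rim.1 hr).1
        simp [h1, n2, hc, one S ht e h1]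
      · by_cases h2 : e ∈ rim E F Sᶜ
        · have := one Sᶜ ht' e h2
          rw [crossing_compl] at this
          simp [h1, h2, hc, this]
        · simp only [h1, h2, hc, if_false]
          rw [card_eq_zero, eq_empty_iff_forall_notMem]
          intro f hf
          rw [mem_filter] at hf
          obtain ⟨v, hv⟩ := exists_mem_sym2 e
          by_cases hvS : v ∈ S
          · rcases mem_inside_or_mem_cut he hv hvS with h3 | h3
            · exact h1 (mem_rim.2 ⟨h3, f, hf⟩)
            · exact hc h3
          · rcases mem_inside_or_mem_cut he hv (mem_compl.2 hvS) with h3 | h3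
            · exact h2 (mem_rim.2 ⟨h3, f, by rwa [crossing_compl]⟩)
            · exact hc (by rwa [cut_compl] at h3)
  rw [sum_congr rfl h3, sum_add_distrib, sum_add_distrib, ← mul_sum]
  have hin : ∀ A : Finset V, rim E F A ⊆ E := fun A e he => inside_subset (mem_rim.1 he).1
  simp only [sum_ite_mem, sum_const, smul_eq_mul, mul_one]
  rw [inter_eq_right.2 (hin S), inter_eq_right.2 (hin Sᶜ), inter_eq_right.2 cut_subset]

/-- Peeling off the vertices `T` of the rim from a thin side. -/
theorem IsCubicMap.exists_layer (h : IsCubicMap E F)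
    (ht : ∀ v ∈ S, ∀ e ∈ cut E S, ∀ e' ∈ cut E S, v ∈ e → v ∈ e' → e = e') :
    ∃ T ⊆ S, #(cut E S) ≤ #T ∧ #T ≤ #(rim E F S) ∧
      #(cut E (S \ T)) + #(cut E S) + 2 * #(rim E F S) ≤ 3 * #T := by
  classical
  have two_other : ∀ v ∈ S, ∀ e ∈ cut E S, v ∈ e → ∀ e' ∈ E, v ∈ e' → e' ≠ e →
      e' ∈ rim E F S := by
    intro v hv e he hve e' he' hve' hne
    obtain ⟨f, hf, hef, hef'⟩ := h.exists_common_face (cut_subset he) he' hve hve' hne.symm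
    rcases mem_inside_or_mem_cut he' hve' hv with h1 | h1
    · exact mem_rim.2 ⟨h1, f, mem_crossing.2 ⟨hf, e, hef, he⟩, hef'⟩
    · exact absurd (ht v hv e' h1 e he hve' hve) hne
  have hnd : ∀ e ∈ rim E F S, ¬ e.IsDiag := fun e he =>
    h.not_isDiag e (inside_subset (mem_rim.1 he).1)
  set T : Finset V := {v ∈ S | ∃ e ∈ rim E F S, v ∈ e} with hT
  have hTS : T ⊆ S := filter_subset _ _
  have hrimT : ∀ e ∈ rim E F S, ∀ v ∈ e, v ∈ T := fun e he v hv =>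
    mem_filter.2 ⟨(mem_inside.1 (mem_rim.1 he).1).2 v hv, e, he, hv⟩
  have hcutT : ∀ e ∈ cut E S, ∀ v ∈ e, v ∈ S → v ∈ T := by
    intro e he v hv hvS
    have h2 : 1 < #{e ∈ E | v ∈ e} := by rw [h.card_incident]; norm_num
    obtain ⟨e', he', hne⟩ := exists_mem_ne h2 e
    rw [mem_filter] at he'
    exact mem_filter.2 ⟨hvS, e', two_other v hvS e he hv e' he'.1 he'.2 hne, he'.2⟩
  refine ⟨T, hTS, ?_, ?_, ?_⟩
  · have h1 := sum_card_incident (H := cut E S)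
      (fun e he => h.not_isDiag e (cut_subset he)) T
    have h2 : cut (cut E S) T = cut E S := by
      refine cut_subset.antisymm fun e he => mem_cut.2 ⟨he, ?_⟩
      obtain ⟨-, ⟨v, hv, hvS⟩, w, hw, hwS⟩ := mem_cut.1 he
      exact ⟨⟨v, hv, hcutT e he v hv hvS⟩, w, hw, fun hwT => hwS (hTS hwT)⟩
    have h3 : ∑ v ∈ T, #{e ∈ cut E S | v ∈ e} ≤ ∑ v ∈ T, 1 := by
      refine sum_le_sum fun v hv => card_le_one.2 fun e he e' he' => ?_
      rw [mem_filter] at he he'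
      exact ht v (hTS hv) e he.1 e' he'.1 he.2 he'.2
    rw [h1, h2, sum_const, smul_eq_mul, mul_one] at h3
    omega
  · have h1 := sum_card_incident hnd T
    have h2 : cut (rim E F S) T = ∅ := by
      rw [eq_empty_iff_forall_notMem]
      intro e he
      obtain ⟨her, -, v, hv, hvT⟩ := mem_cut.1 he
      exact hvT (hrimT e her v hv)
    have h3 : ∑ v ∈ T, 2 ≤ ∑ v ∈ T, #{e ∈ rim E F S | v ∈ e} := by
      refine sum_le_sum fun v hv => ?_
      obtain ⟨hvS, e, he, hve⟩ := mem_filter.1 hv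
      obtain ⟨heS, f, hf, hef⟩ := mem_rim.1 he
      have hfF := (mem_crossing.1 hf).1
      obtain ⟨e', hef', hve', hne⟩ := h.exists_ne_of_mem_face hfF hef hve
      have heE' := h.face_subset f hfF hef'
      rw [Nat.succ_le_iff, one_lt_card]
      rcases mem_inside_or_mem_cut heE' hve' hvS with h4 | h4
      · exact ⟨e, mem_filter.2 ⟨he, hve⟩, e',
          mem_filter.2 ⟨mem_rim.2 ⟨h4, f, hf, hef'⟩, hve'⟩, hne.symm⟩
      · have h5 : 2 < #{e ∈ E | v ∈ e} := by rw [h.card_incident]; norm_num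
        obtain ⟨x, hx, hxe, hxe'⟩ : ∃ x ∈ ({e ∈ E | v ∈ e} : Finset _), x ≠ e ∧ x ≠ e' := by
          by_contra! hcon
          have : ({e ∈ E | v ∈ e} : Finset _) ⊆ {e, e'} := by
            intro x hx
            by_cases hxe : x = e
            · simp [hxe]
            · simp [hcon x hx hxe]
          have := (card_le_card this).trans card_le_two
          omega
        rw [mem_filter] at hx
        exact ⟨e, mem_filter.2 ⟨he, hve⟩, x,
          mem_filter.2 ⟨two_other v hvS e' h4 hve' x hx.1 hx.2 hxe', hx.2⟩, hxe.symm⟩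
    rw [h1, h2, sum_const, smul_eq_mul, card_empty] at h3
    have h4 := card_le_card (inside_subset (H := rim E F S) (S := T))
    omega
  · have h1 := h.three_mul_card T
    have h2 : #(rim E F S) ≤ #(inside E T) := card_le_card fun e he =>
      mem_inside.2 ⟨inside_subset (mem_rim.1 he).1, hrimT e he⟩
    have hdisj : Disjoint (cut E (S \ T)) (cut E S) := by
      rw [Finset.disjoint_left]
      intro e he he'
      obtain ⟨-, ⟨v, hv, hvS⟩, -⟩ := mem_cut.1 he
      rw [mem_sdiff] at hvS
      exact hvS.2 (hcutT e he' v hv hvS.1)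
    have h3 : cut E (S \ T) ∪ cut E S ⊆ cut E T := by
      intro e he
      rw [mem_union] at he
      rcases he with he | he
      · obtain ⟨heE, ⟨v, hv, hvS⟩, w, hw, hwS⟩ := mem_cut.1 he
        rw [mem_sdiff] at hvS hwS
        refine mem_cut.2 ⟨heE, ⟨w, hw, ?_⟩, v, hv, hvS.2⟩
        by_contra hwT
        have hwS' : w ∉ S := fun h => hwS ⟨h, hwT⟩
        exact hvS.2 (hcutT e (mem_cut.2 ⟨heE, ⟨v, hv, hvS.1⟩, w, hw, hwS'⟩) v hv hvS.1)
      · obtain ⟨heE, ⟨v, hv, hvS⟩, w, hw, hwS⟩ := mem_cut.1 he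
        exact mem_cut.2 ⟨heE, ⟨v, hv, hcutT e he v hv hvS⟩, w, hw, fun h => hwS (hTS h)⟩
    have h4 := card_le_card h3
    rw [card_union_of_disjoint hdisj] at h4
    omega

end Bond

section SmallCuts

variable {E : Finset (Sym2 V)} {F : Finset (Finset (Sym2 V))} {S : Finset V}

/-- An edge cut with at most four edges such that neither side is smaller than the cut. -/
structure IsSmallCut (E : Finset (Sym2 V)) (S : Finset V) : Prop where
  nonempty : S.Nonempty
  compl_nonempty : Sᶜ.Nonempty
  le_four : #(cut E S) ≤ 4
  le_card : #(cut E S) ≤ #S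
  le_card_compl : #(cut E S) ≤ #Sᶜ

theorem IsSmallCut.compl (hs : IsSmallCut E S) : IsSmallCut E Sᶜ where
  nonempty := hs.compl_nonempty
  compl_nonempty := by rw [compl_compl]; exact hs.nonempty
  le_four := by rw [cut_compl]; exact hs.le_four
  le_card := by rw [cut_compl]; exact hs.le_card_compl
  le_card_compl := by rw [cut_compl, compl_compl]; exact hs.le_card

theorem IsSmallCut.of_subset (hs : IsSmallCut E S) {A : Finset V} (hA : A ⊆ S)
    (hne : A.Nonempty) (hcut : #(cut E A) ≤ #(cut E S)) (hcard : #(cut E A) ≤ #A) :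
    IsSmallCut E A := by
  have hc : Sᶜ ⊆ Aᶜ := compl_subset_compl.2 hA
  exact ⟨hne, hs.compl_nonempty.mono hc, hcut.trans hs.le_four, hcard,
    hcut.trans (hs.le_card_compl.trans (card_le_card hc))⟩

/-- If at most one edge inside `S` joins `A ⊆ S` to `S \ A`, then passing to `A` and `S \ A`
adds at most two cut edges. -/
theorem IsCubicMap.cut_add_cut_le (h : IsCubicMap E F) {A : Finset V} (hA : A ⊆ S)
    {D : Finset (Sym2 V)}
    (hD : ∀ e ∈ inside E S \ D, (∃ v ∈ e, v ∈ A) → ¬ ∃ v ∈ e, v ∈ S \ A) :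
    #(cut E A) + #(cut E (S \ A)) ≤ #(cut E S) + 2 * #D := by
  classical
  have h1 := h.three_mul_card S
  have h2 := h.three_mul_card A
  have h3 := h.three_mul_card (S \ A)
  have h4 := card_sdiff_add_card_eq_card hA
  have h5 : inside E S ⊆ inside E A ∪ inside E (S \ A) ∪ D := by
    intro e he
    by_cases heD : e ∈ D
    · exact mem_union_right _ heD
    refine mem_union_left _ (mem_union.2 ?_)
    have hd := hD e (mem_sdiff.2 ⟨he, heD⟩)
    obtain ⟨heE, heS⟩ := mem_inside.1 he
    by_cases hA : ∃ v ∈ e, v ∈ A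
    · left
      refine mem_inside.2 ⟨heE, fun w hw => ?_⟩
      by_contra hwA
      exact hd hA ⟨w, hw, mem_sdiff.2 ⟨heS w hw, hwA⟩⟩
    · right
      exact mem_inside.2 ⟨heE, fun w hw => mem_sdiff.2 ⟨heS w hw, fun hwA => hA ⟨w, hw, hwA⟩⟩⟩
  have h6 := (card_le_card h5).trans ((card_union_le _ _).trans
    (Nat.add_le_add_right (card_union_le _ _) _))
  omega

theorem IsCubicMap.cutConnected_of_isSmallCut (h : IsCubicMap E F) (hs : IsSmallCut E S) :
    CutConnected (inside E S) S := by
  intro A hA hne hAS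
  by_contra! hcon
  have hne' : (S \ A).Nonempty := sdiff_nonempty.2 fun hSA => hAS (hA.antisymm hSA)
  have h1 := h.cut_add_cut_le hA (D := ∅) (by
    intro e he hv ⟨w, hw, hwA⟩
    rw [sdiff_empty] at he
    exact hcon e he hv w hw hwA)
  rw [card_empty] at h1
  have hc : ∀ B ⊆ S, B.Nonempty → 3 ≤ #(cut E B) := fun B hB hBne =>
    h.three_le_cut B hBne (hs.compl_nonempty.mono (compl_subset_compl.2 hB))
  have h2 := hc A hA hne
  have h3 := hc (S \ A) sdiff_subset hne'
  have := hs.le_four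
  omega

theorem IsCubicMap.cut_unique_of_minimal (h : IsCubicMap E F) (hs : IsSmallCut E S)
    (hmin : ∀ A, IsSmallCut E A → #(cut E S) ≤ #(cut E A)) :
    ∀ v ∈ S, ∀ e ∈ cut E S, ∀ e' ∈ cut E S, v ∈ e → v ∈ e' → e = e' := by
  classical
  intro v hv e he e' he' hve hve'
  by_contra hne
  have h1 := h.three_mul_card S
  have h2 := h.three_mul_card (S.erase v)
  have h3 := card_erase_add_one hv
  have h4 : #{x ∈ inside E S | v ∈ x} ≤ 1 := by
    have hsub : ({x ∈ inside E S | v ∈ x} : Finset _) ∪ {e, e'} ⊆ {x ∈ E | v ∈ x} := by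
      intro x hx
      simp only [mem_union, mem_filter, mem_insert, mem_singleton] at hx
      rcases hx with hx | rfl | rfl
      · exact mem_filter.2 ⟨inside_subset hx.1, hx.2⟩
      · exact mem_filter.2 ⟨cut_subset he, hve⟩
      · exact mem_filter.2 ⟨cut_subset he', hve'⟩
    have hdisj : Disjoint ({x ∈ inside E S | v ∈ x} : Finset _) {e, e'} := by
      rw [Finset.disjoint_left]
      intro x hx hx'
      simp only [mem_insert, mem_singleton] at hx'
      rw [mem_filter] at hx
      rcases hx' with rfl | rfl
      · exact Finset.disjoint_left.1 disjoint_inside_cut hx.1 he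
      · exact Finset.disjoint_left.1 disjoint_inside_cut hx.1 he'
    have := card_le_card hsub
    rw [card_union_of_disjoint hdisj, card_pair hne, h.card_incident] at this
    omega
  have h5 : inside E S ⊆ inside E (S.erase v) ∪ {x ∈ inside E S | v ∈ x} := by
    intro x hx
    by_cases hvx : v ∈ x
    · exact mem_union_right _ (mem_filter.2 ⟨hx, hvx⟩)
    · refine mem_union_left _ (mem_inside.2 ⟨inside_subset hx, fun w hw => ?_⟩)
      refine mem_erase.2 ⟨?_, (mem_inside.1 hx).2 w hw⟩
      rintro rfl
      exact hvx hw
  have h6 := (card_le_card h5).trans (card_union_le _ _)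
  have h7 := h.three_le_cut S hs.nonempty hs.compl_nonempty
  have h8 := hs.le_card
  have h9 := hmin (S.erase v) (hs.of_subset (erase_subset _ _)
    (card_pos.1 (by omega)) (by omega) (by omega))
  omega

theorem IsCubicMap.face_unique_of_minimal (h : IsCubicMap E F) (hs : IsSmallCut E S)
    (hb : IsBond E S) (hmin : ∀ A, IsSmallCut E A → #(cut E S) ≤ #(cut E A)) :
    ∀ e ∈ inside E S, ∀ f ∈ crossing E F S, ∀ g ∈ crossing E F S, e ∈ f → e ∈ g → f = g := by
  classical
  intro e he f hf g hg hef heg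
  by_contra hne
  have hfaces : ({k ∈ F | e ∈ k} : Finset _) = {f, g} := by
    symm
    apply eq_of_subset_of_card_le
    · intro k hk
      simp only [mem_insert, mem_singleton] at hk
      rcases hk with rfl | rfl
      · exact mem_filter.2 ⟨(mem_crossing.1 hf).1, hef⟩
      · exact mem_filter.2 ⟨(mem_crossing.1 hg).1, heg⟩
    · rw [h.card_faces e (inside_subset he), card_pair hne]
  have hnotin : ∀ k ∈ crossing E F S, ¬ k ⊆ inside E S := by
    intro k hk hkS
    obtain ⟨-, x, hx, hxc⟩ := mem_crossing.1 hk
    exact Finset.disjoint_left.1 disjoint_inside_cut (hkS hx) hxc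
  have havoid : ∀ k ∈ F, k ⊆ inside E S → e ∉ k := by
    intro k hk hkS hek
    have : k ∈ ({f, g} : Finset _) := by rw [← hfaces]; exact mem_filter.2 ⟨hk, hek⟩
    simp only [mem_insert, mem_singleton] at this
    rcases this with rfl | rfl
    · exact hnotin _ hf hkS
    · exact hnotin _ hg hkS
  have hnc : ¬ CutConnected ((inside E S).erase e) S := by
    intro hconn
    have h1 := h.card_faces_add_card_le (H := (inside E S).erase e)
      ((erase_subset _ _).trans inside_subset) (by
        refine inside_subset.antisymm fun x hx => mem_inside.2 ⟨hx, ?_⟩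
        exact (mem_inside.1 (mem_of_mem_erase hx)).2) hconn
      (h.faces_inside_ne hb.nonempty hb.compl_nonempty (erase_subset _ _))
    have h2 : ({k ∈ F | k ⊆ (inside E S).erase e} : Finset _) = {k ∈ F | k ⊆ inside E S} := by
      ext k
      simp only [mem_filter, and_congr_right_iff, subset_erase]
      exact fun hk => ⟨fun hk' => hk'.1, fun hk' => ⟨hk', havoid k hk hk'⟩⟩
    rw [h2] at h1
    have h3 := (h.bond_counts hb).2
    have h4 := card_erase_add_one he
    omega
  simp only [CutConnected, not_forall] at hnc
  obtain ⟨A, hA, hAne, hAS, hcon⟩ := hnc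
  have hne' : (S \ A).Nonempty := sdiff_nonempty.2 fun hSA => hAS (hA.antisymm hSA)
  have h1 := h.cut_add_cut_le hA (D := {e}) (by
    intro x hx hv hw
    rw [sdiff_singleton_eq_erase] at hx
    exact hcon ⟨x, hx, hv, hw⟩)
  rw [card_singleton] at h1
  have hc : ∀ B ⊆ S, B.Nonempty → 3 ≤ #(cut E B) := fun B hB hBne =>
    h.three_le_cut B hBne (hs.compl_nonempty.mono (compl_subset_compl.2 hB))
  have h2 := hc A hA hAne
  have h3 := hc (S \ A) sdiff_subset hne'
  have h4 := h.three_mul_card A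
  have h5 := h.three_mul_card (S \ A)
  have h6 := card_sdiff_add_card_eq_card hA
  have h7 := h.three_mul_card S
  have h8 := hs.le_card
  by_cases hbig : #(cut E A) ≤ #A
  · have := hmin A (hs.of_subset hA hAne (by omega) hbig)
    omega
  · have := hmin (S \ A) (hs.of_subset sdiff_subset hne' (by omega) (by omega))
    omega

theorem IsCubicMap.thin_of_minimal (h : IsCubicMap E F) (hs : IsSmallCut E S)
    (hmin : ∀ A, IsSmallCut E A → #(cut E S) ≤ #(cut E A)) :
    IsBond E S ∧ IsThinSide E F S ∧ IsThinSide E F Sᶜ := by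
  have hmin' : ∀ A, IsSmallCut E A → #(cut E Sᶜ) ≤ #(cut E A) := by
    rw [cut_compl]; exact hmin
  have hb : IsBond E S := ⟨hs.nonempty, hs.compl_nonempty, h.cutConnected_of_isSmallCut hs,
    h.cutConnected_of_isSmallCut hs.compl⟩
  exact ⟨hb, ⟨h.cut_unique_of_minimal hs hmin, h.face_unique_of_minimal hs hb hmin⟩,
    ⟨h.cut_unique_of_minimal hs.compl hmin',
      h.face_unique_of_minimal hs.compl hb.compl hmin'⟩⟩

/-- Cyclic 5-edge-connectivity. -/
theorem IsCubicMap.not_isSmallCut (h : IsCubicMap E F) (S : Finset V) : ¬ IsSmallCut E S := by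
  classical
  intro hS
  obtain ⟨S₀, hS₀, hmin₀⟩ := exists_min_image ({A | IsSmallCut E A} : Finset (Finset V))
    (fun A => #(cut E A)) ⟨S, by simpa using hS⟩
  simp only [mem_filter, mem_univ, true_and] at hS₀ hmin₀
  obtain ⟨S₁, hS₁, hmin₁⟩ := exists_min_image
    ({A | IsSmallCut E A ∧ #(cut E A) = #(cut E S₀)} : Finset (Finset V))
    (fun A => #A) ⟨S₀, by simpa using hS₀⟩
  simp only [mem_filter, mem_univ, true_and] at hS₁ hmin₁
  obtain ⟨hs, hk⟩ := hS₁
  have hmin : ∀ A, IsSmallCut E A → #(cut E S₁) ≤ #(cut E A) := by rw [hk]; exact hmin₀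
  obtain ⟨hb, ht, ht'⟩ := h.thin_of_minimal hs hmin
  obtain ⟨T, hT, h1, h2, h3⟩ := h.exists_layer ht.cut_unique
  obtain ⟨T', hT', h1', h2', h3'⟩ := h.exists_layer ht'.cut_unique
  have h4 := h.card_rim_le hb
  have h4' := h.card_rim_le hb.compl
  have h5 := h.sum_card_crossing ht ht'
  have h6 : ∑ f ∈ crossing E F S₁, #f ≤ #(crossing E F S₁) * 6 :=
    sum_le_card_nsmul _ _ _ fun f hf => h.le_six f (mem_crossing.1 hf).1
  rw [(h.bond_counts hb).1] at h6
  rw [cut_compl] at h1' h3' h4'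
  have h7 := card_sdiff_add_card_eq_card hT
  have h7' := card_sdiff_add_card_eq_card hT'
  have h8 := hs.le_four
  have h9 := h.three_le_cut S₁ hs.nonempty hs.compl_nonempty
  have hlow' : #(cut E S₁) ≤ #(cut E (S₁ᶜ \ T')) := by
    by_contra! hlt
    have hs' := hs.compl.of_subset (A := S₁ᶜ \ T') sdiff_subset (card_pos.1 (by omega))
      (by rw [cut_compl]; omega) (by omega)
    have := hmin _ hs'
    omega
  have hnew := hs.of_subset (A := S₁ \ T) sdiff_subset (card_pos.1 (by omega))
    (by omega) (by omega)
  have h10 := hmin _ hnew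
  have h11 := hmin₁ (S₁ \ T) ⟨hnew, by omega⟩
  omega

end SmallCuts

section Ring

variable {E : Finset (Sym2 V)} {F : Finset (Finset (Sym2 V))} {S : Finset V}

/-- A thin side of a five-edge bond whose rim is short is a single pentagon. -/
theorem IsCubicMap.rim_mem_faces (h : IsCubicMap E F) (hb : IsBond E S)
    (ht : IsThinSide E F S) (hcut : #(cut E S) = 5) (hrim : #(rim E F S) ≤ 9) :
    rim E F S ∈ F := by
  classical
  obtain ⟨T, hT, h1, h2, h3⟩ := h.exists_layer ht.cut_unique
  have h4 := h.card_rim_le hb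
  have h5 := card_sdiff_add_card_eq_card hT
  have hempty : #(S \ T) = 0 := by
    by_contra hne
    have hTc : T ⊆ (S \ T)ᶜ := fun v hv => by simp [hv]
    have hTc' := card_le_card hTc
    refine h.not_isSmallCut (S \ T) ⟨card_pos.1 (by omega), card_pos.1 (by omega), ?_, ?_, ?_⟩ <;>
      omega
  have h6 := h.three_mul_card S
  have h7 := (h.bond_counts hb).2
  have hsub : rim E F S ⊆ inside E S := fun e he => (mem_rim.1 he).1
  have heq : rim E F S = inside E S := eq_of_subset_of_card_le hsub (by omega)
  obtain ⟨f, hf⟩ := card_pos.1 (show 0 < #{f ∈ F | f ⊆ inside E S} by omega)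
  rw [mem_filter] at hf
  have h8 := h.five_le f hf.1
  rw [heq, ← eq_of_subset_of_card_le hf.2 (by omega)]
  exact hf.1

theorem IsCubicMap.eq_or_eq_of_mem (h : IsCubicMap E F) {f g k : Finset (Sym2 V)} (hf : f ∈ F)
    (hg : g ∈ F) (hne : f ≠ g) {e : Sym2 V} (hef : e ∈ f) (heg : e ∈ g) (hk : k ∈ F)
    (hek : e ∈ k) : k = f ∨ k = g := by
  have hs : ({f, g} : Finset _) ⊆ {f ∈ F | e ∈ f} := by
    intro x hx
    simp only [mem_insert, mem_singleton] at hx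
    rcases hx with rfl | rfl
    · exact mem_filter.2 ⟨hf, hef⟩
    · exact mem_filter.2 ⟨hg, heg⟩
  have he := eq_of_subset_of_card_le hs
    (by rw [h.card_faces e (h.face_subset f hf hef), card_pair hne])
  have : k ∈ ({f, g} : Finset _) := by rw [he]; exact mem_filter.2 ⟨hk, hek⟩
  simpa using this

variable {ring : ZMod 5 → Finset (Sym2 V)} {e : ZMod 5 → Sym2 V}

theorem ring_eq_of_mem (h : IsCubicMap E F) (hring : IsFaceRing F 5 ring)
    (he : ∀ i, ring i ∩ ring (i + 1) = {e i}) {i : ZMod 5} {f : Finset (Sym2 V)} (hf : f ∈ F)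
    (hif : e i ∈ f) : f = ring i ∨ f = ring (i + 1) := by
  obtain ⟨-, hinj, hF, -⟩ := hring
  have hi : e i ∈ ring i ∩ ring (i + 1) := by rw [he]; exact mem_singleton_self _
  rw [mem_inter] at hi
  refine h.eq_or_eq_of_mem (hF i) (hF (i + 1)) (fun heq => ?_) hi.1 hi.2 hf hif
  exact (by decide : ∀ j : ZMod 5, j ≠ j + 1) i (hinj heq)

theorem mem_image_of_mem_ring (hring : IsFaceRing F 5 ring)
    (he : ∀ i, ring i ∩ ring (i + 1) = {e i}) {i j : ZMod 5} (hij : i ≠ j) {x : Sym2 V}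
    (hi : x ∈ ring i) (hj : x ∈ ring j) : x ∈ univ.image e := by
  obtain ⟨-, -, -, -, hdisj, -⟩ := hring
  rw [mem_image]
  by_cases h1 : j = i + 1
  · subst h1
    have : x ∈ ring i ∩ ring (i + 1) := mem_inter.2 ⟨hi, hj⟩
    rw [he, mem_singleton] at this
    exact ⟨i, mem_univ _, this.symm⟩
  by_cases h2 : j = i - 1
  · obtain rfl : i = j + 1 := by rw [h2]; ring
    have : x ∈ ring j ∩ ring (j + 1) := mem_inter.2 ⟨hj, hi⟩
    rw [he, mem_singleton] at this
    exact ⟨j, mem_univ _, this.symm⟩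
  obtain ⟨v, hv⟩ := exists_mem_sym2 x
  exact (Set.disjoint_left.1 (hdisj i j hij.symm h1 h2) ⟨x, hi, hv⟩ ⟨x, hj, hv⟩).elim

theorem injective_spokes (hring : IsFaceRing F 5 ring)
    (he : ∀ i, ring i ∩ ring (i + 1) = {e i}) : Function.Injective e := by
  obtain ⟨-, -, -, -, -, hmat⟩ := hring
  intro i j hij
  by_contra hne
  obtain ⟨v, hv⟩ := exists_mem_sym2 (e i)
  exact hmat i j hne (e i) (by rw [he]; simp) (e j) (by rw [he]; simp) v hv (hij ▸ hv)

/-- The five edges shared by consecutive faces of a ring form an edge cut. -/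
theorem exists_cut_eq_spokes (h : IsCubicMap E F) (hring : IsFaceRing F 5 ring)
    (he : ∀ i, ring i ∩ ring (i + 1) = {e i}) :
    ∃ A : Finset V, cut E A = univ.image e := by
  classical
  have hmem : ∀ i, e i ∈ ring i ∧ e i ∈ ring (i + 1) := fun i => by
    rw [← mem_inter, he]; exact mem_singleton_self _
  have hF := hring.2.2.1
  have hinj := hring.2.1
  have hDE : univ.image e ⊆ E := by
    intro x hx
    obtain ⟨i, -, rfl⟩ := mem_image.1 hx
    exact h.face_subset _ (hF i) (hmem i).1
  have hDcard : #(univ.image e) = 5 := by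
    rw [card_image_of_injective _ (injective_spokes hring he)]; rfl
  have hRcard : #(univ.image ring) = 5 := by
    rw [card_image_of_injective _ hinj]; rfl
  have hfaces : ({f ∈ F | f ⊆ E \ univ.image e} : Finset _) = F \ univ.image ring := by
    ext f
    simp only [mem_filter, mem_sdiff, and_congr_right_iff, mem_image, mem_univ, true_and]
    intro hf
    constructor
    · rintro hsub ⟨i, rfl⟩
      exact (mem_sdiff.1 (hsub (hmem i).1)).2 (mem_image_of_mem _ (mem_univ i))
    · intro hnot x hx
      refine mem_sdiff.2 ⟨h.face_subset f hf hx, fun hxD => ?_⟩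
      obtain ⟨i, -, rfl⟩ := mem_image.1 hxD
      rcases ring_eq_of_mem h hring he hf hx with rfl | rfl
      · exact hnot ⟨i, rfl⟩
      · exact hnot ⟨i + 1, rfl⟩
  have hsubR : univ.image ring ⊆ F := by
    intro f hf
    obtain ⟨i, -, rfl⟩ := mem_image.1 hf
    exact hF i
  have hnc : ¬ CutConnected (E \ univ.image e) univ := by
    intro hconn
    have h1 := h.card_faces_add_card_le sdiff_subset
      (by ext x; simp [mem_inside]) hconn (by
        rw [hfaces]
        intro heq
        have := hF 0
        rw [← heq] at this
        exact (mem_sdiff.1 this).2 (mem_image_of_mem _ (mem_univ 0)))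
    have h2 := card_sdiff_add_card_eq_card hsubR
    have h3 := card_sdiff_add_card_eq_card hDE
    have h4 := h.euler
    rw [hfaces, card_univ] at h1
    omega
  simp only [CutConnected, not_forall] at hnc
  obtain ⟨A, -, hAne, hAS, hcon⟩ := hnc
  have hAc : Aᶜ.Nonempty := by
    rw [nonempty_iff_ne_empty, Ne, compl_eq_empty_iff]
    exact hAS
  have hsub : cut E A ⊆ univ.image e := by
    intro x hx
    by_contra hxD
    obtain ⟨hxE, hv, w, hw, hwA⟩ := mem_cut.1 hx
    exact hcon ⟨x, mem_sdiff.2 ⟨hxE, hxD⟩, hv, w, hw, by simpa using hwA⟩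
  have hstep : ∀ i, e i ∈ cut E A → e (i + 1) ∈ cut E A := by
    intro i hi
    by_contra hi'
    have hone : cut (ring (i + 1)) A = {e i} := by
      ext x
      rw [h.mem_cut_face (hF _), mem_singleton]
      constructor
      · rintro ⟨hx, hxc⟩
        obtain ⟨j, -, rfl⟩ := mem_image.1 (hsub hxc)
        rcases ring_eq_of_mem h hring he (hF _) hx with heq | heq
        · rw [← hinj heq] at hxc
          exact absurd hxc hi'
        · rw [add_right_cancel (hinj heq)]
      · rintro rfl
        exact ⟨(hmem i).2, hi⟩
    have hev := h.even_card_cut_face (hF (i + 1)) A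
    rw [hone, card_singleton] at hev
    exact absurd hev (by decide)
  refine ⟨A, hsub.antisymm ?_⟩
  have hpos := h.three_le_cut A hAne hAc
  obtain ⟨x, hx⟩ := card_pos.1 (show 0 < #(cut E A) by omega)
  obtain ⟨i, -, rfl⟩ := mem_image.1 (hsub hx)
  intro y hy
  obtain ⟨j, -, rfl⟩ := mem_image.1 hy
  have hcyc : ∀ a b : ZMod 5,
      b = a ∨ b = a + 1 ∨ b = a + 1 + 1 ∨ b = a + 1 + 1 + 1 ∨ b = a + 1 + 1 + 1 + 1 := by
    decide
  have s1 := hstep _ hx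
  have s2 := hstep _ s1
  have s3 := hstep _ s2
  have s4 := hstep _ s3
  rcases hcyc i j with rfl | rfl | rfl | rfl | rfl <;> assumption

theorem crossing_eq_image_ring (h : IsCubicMap E F) (hring : IsFaceRing F 5 ring)
    (he : ∀ i, ring i ∩ ring (i + 1) = {e i}) (hS : cut E S = univ.image e) :
    crossing E F S = univ.image ring := by
  ext f
  simp only [mem_crossing, hS, mem_image, mem_univ, true_and]
  constructor
  · rintro ⟨hf, -, hx, i, rfl⟩
    rcases ring_eq_of_mem h hring he hf hx with rfl | rfl
    exacts [⟨i, rfl⟩, ⟨i + 1, rfl⟩]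
  · rintro ⟨i, rfl⟩
    refine ⟨hring.2.2.1 i, e i, ?_, i, rfl⟩
    have hi : e i ∈ ring i ∩ ring (i + 1) := by rw [he]; exact mem_singleton_self _
    exact (mem_inter.1 hi).1

theorem isThinSide_of_ring (h : IsCubicMap E F) (hring : IsFaceRing F 5 ring)
    (he : ∀ i, ring i ∩ ring (i + 1) = {e i}) (hS : cut E S = univ.image e) :
    IsThinSide E F S where
  cut_unique := by
    intro v _ x hx y hy hvx hvy
    rw [hS] at hx hy
    obtain ⟨i, -, rfl⟩ := mem_image.1 hx
    obtain ⟨j, -, rfl⟩ := mem_image.1 hy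
    by_contra hne
    exact hring.2.2.2.2.2 i j (fun hij => hne (hij ▸ rfl)) (e i) (by rw [he]; simp) (e j)
      (by rw [he]; simp) v hvx hvy
  face_unique := by
    intro x hx f hf g hg hxf hxg
    rw [crossing_eq_image_ring h hring he hS] at hf hg
    obtain ⟨i, -, rfl⟩ := mem_image.1 hf
    obtain ⟨j, -, rfl⟩ := mem_image.1 hg
    by_contra hne
    have := mem_image_of_mem_ring hring he (fun hij => hne (congrArg ring hij)) hxf hxg
    rw [← hS] at this
    exact Finset.disjoint_left.1 disjoint_inside_cut hx this

/-- A side of a cut is connected if it contains a connected set meeting all the cut edges. -/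
theorem cutConnected_of_ends (h : IsCubicMap E F) {T : Finset V} (hSc : Sᶜ.Nonempty)
    (hconn : ∀ A : Finset V, Disjoint (cut E A) (inside E S) → T ⊆ A ∨ T ⊆ Aᶜ)
    (hends : ∀ x ∈ cut E S, ∀ v ∈ x, v ∈ S → v ∈ T) : CutConnected (inside E S) S := by
  intro A hA hne hAS
  by_contra! hcon
  have hne' : (S \ A).Nonempty := sdiff_nonempty.2 fun hSA => hAS (hA.antisymm hSA)
  have key : ∀ B ⊆ S, B.Nonempty → T ⊆ Bᶜ → Disjoint (cut E B) (inside E S) → False := by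
    intro B hB hBne hTB hdis
    have h1 := h.three_le_cut B hBne (hSc.mono (compl_subset_compl.2 hB))
    obtain ⟨x, hx⟩ := card_pos.1 (show 0 < #(cut E B) by omega)
    obtain ⟨hxE, ⟨v, hv, hvB⟩, -⟩ := mem_cut.1 hx
    rcases mem_inside_or_mem_cut hxE hv (hB hvB) with h2 | h2
    · exact Finset.disjoint_left.1 hdis hx h2
    · exact mem_compl.1 (hTB (hends x h2 v hv (hB hvB))) hvB
  have hd : Disjoint (cut E A) (inside E S) := by
    rw [Finset.disjoint_left]
    intro x hx hxS
    obtain ⟨-, hv, w, hw, hwA⟩ := mem_cut.1 hx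
    exact hcon x hxS hv w hw (mem_sdiff.2 ⟨(mem_inside.1 hxS).2 w hw, hwA⟩)
  have hd' : Disjoint (cut E (S \ A)) (inside E S) := by
    rw [Finset.disjoint_left]
    intro x hx hxS
    obtain ⟨-, ⟨v, hv, hvA⟩, w, hw, hwA⟩ := mem_cut.1 hx
    have hwS := (mem_inside.1 hxS).2 w hw
    refine hcon x hxS ⟨w, hw, ?_⟩ v hv hvA
    by_contra hwA'
    exact hwA (mem_sdiff.2 ⟨hwS, hwA'⟩)
  rcases hconn A hd with hT | hT
  · refine key (S \ A) sdiff_subset hne' (fun v hv => ?_) hd'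
    simp [hT hv]
  · exact key A hA hne hT hd

end Ring

section Graph

variable {G : SimpleGraph V} {faces : Finset (Finset (Sym2 V))}

/-- The edges of a finite graph. -/
noncomputable def edges (G : SimpleGraph V) : Finset (Sym2 V) := (Set.toFinite G.edgeSet).toFinset

theorem mem_edges {e : Sym2 V} : e ∈ edges G ↔ e ∈ G.edgeSet := by simp [edges]

theorem card_incident_eq_ncard {H : Finset (Sym2 V)} {v : V} {N : Set V}
    (hN : ∀ w, s(v, w) ∈ H ↔ w ∈ N) : #{e ∈ H | v ∈ e} = N.ncard := by
  classical
  have h1 : ({e ∈ H | v ∈ e} : Finset _) = (Set.toFinite N).toFinset.image (fun w => s(v, w)) := by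
    ext e
    simp only [mem_filter, mem_image, Set.Finite.mem_toFinset]
    constructor
    · rintro ⟨he, hv⟩
      obtain ⟨w, rfl⟩ := Sym2.mem_iff_exists.1 hv
      exact ⟨w, (hN w).1 he, rfl⟩
    · rintro ⟨w, hw, rfl⟩
      exact ⟨(hN w).2 hw, Sym2.mem_mk_left v w⟩
  rw [h1, card_image_of_injective _ (fun a b hab => Sym2.congr_right.1 hab),
    Set.ncard_eq_toFinset_card N]

theorem mem_iff_of_walk {S : Finset V} {u v : V} (p : G.Walk u v)
    (hp : ∀ e ∈ p.edges, e ∉ cut (edges G) S) : ∀ x ∈ p.support, x ∈ S ↔ u ∈ S := by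
  induction p with
  | nil => simp
  | @cons a b c hab p ih =>
    have hb : b ∈ S ↔ a ∈ S := by
      have h1 := hp s(a, b) (by simp)
      rw [mem_cut] at h1
      by_contra hcon
      refine h1 ⟨mem_edges.2 hab, ?_⟩
      by_cases ha : a ∈ S
      · exact ⟨⟨a, by simp, ha⟩, b, by simp, fun hb => hcon (by tauto)⟩
      · exact ⟨⟨b, by simp, by tauto⟩, a, by simp, ha⟩
    intro x hx
    rw [SimpleGraph.Walk.support_cons, List.mem_cons] at hx
    rcases hx with rfl | hx
    · rfl
    · exact (ih (fun e he => hp e (by simp [he])) x hx).trans hb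

theorem mem_support_of_mem_edge {u v x : V} {p : G.Walk u v} {e : Sym2 V} (he : e ∈ p.edges)
    (hx : x ∈ e) : x ∈ p.support := by
  obtain ⟨y, rfl⟩ := Sym2.mem_iff_exists.1 hx
  exact p.fst_mem_support_of_mem_edges he

theorem card_incident_cycle {u : V} {c : G.Walk u u} (hc : c.IsCycle) (v : V) :
    #{e ∈ c.edges.toFinset | v ∈ e} = 0 ∨ #{e ∈ c.edges.toFinset | v ∈ e} = 2 := by
  by_cases hv : v ∈ c.support
  · right
    rw [← hc.ncard_neighborSet_toSubgraph_eq_two hv]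
    refine card_incident_eq_ncard fun w => ?_
    rw [List.mem_toFinset, SimpleGraph.Subgraph.mem_neighborSet,
      ← SimpleGraph.Subgraph.mem_edgeSet, SimpleGraph.Walk.mem_edges_toSubgraph]
  · left
    rw [card_eq_zero, eq_empty_iff_forall_notMem]
    intro e he
    rw [mem_filter, List.mem_toFinset] at he
    exact hv (mem_support_of_mem_edge he.1 he.2)

theorem card_inside_lt {H : Finset (Sym2 V)} (hH : ∀ e ∈ H, ¬ e.IsDiag) {S : Finset V}
    (hS : S.Nonempty) (hcard : #S ≤ 2) : #(inside H S) < #S := by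
  have hpos := hS.card_pos
  rcases (by omega : #S = 1 ∨ #S = 2) with h1 | h1
  · obtain ⟨a, rfl⟩ := card_eq_one.1 h1
    rw [h1, Nat.lt_one_iff, card_eq_zero, eq_empty_iff_forall_notMem]
    intro e he
    obtain ⟨heH, hall⟩ := mem_inside.1 he
    induction e with | _ x y =>
    have hx := hall x (by simp)
    have hy := hall y (by simp)
    rw [mem_singleton] at hx hy
    exact hH _ heH (by simp [hx, hy])
  · rw [h1, Nat.lt_succ_iff]
    obtain ⟨a, b, hab, rfl⟩ := card_eq_two.1 h1
    refine (card_le_card (t := {s(a, b)}) fun e he => ?_).trans_eq (card_singleton _)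
    obtain ⟨heH, hall⟩ := mem_inside.1 he
    have hd := hH e heH
    induction e with | _ x y =>
    have hx := hall x (by simp)
    have hy := hall y (by simp)
    simp only [mem_insert, mem_singleton] at hx hy
    have hxy : x ≠ y := by simpa using hd
    rcases hx with rfl | rfl <;> rcases hy with rfl | rfl <;> simp_all [Sym2.eq_swap]

theorem three_le_card_cut (hF : IsFullerene G faces) {S : Finset V} (hS : S.Nonempty)
    (hSc : Sᶜ.Nonempty) : 3 ≤ #(cut (edges G) S) := by
  classical
  by_contra! hlt
  have hnd : ∀ e ∈ edges G, ¬ e.IsDiag := fun e he =>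
    G.not_isDiag_of_mem_edgeSet (mem_edges.1 he)
  have hdeg := sum_card_incident hnd S
  rw [sum_congr rfl fun v _ => (card_incident_eq_ncard fun w => by
    rw [mem_edges, SimpleGraph.mem_edgeSet, SimpleGraph.mem_neighborSet]).trans (hF.cubic v),
    sum_const, smul_eq_mul] at hdeg
  set s : Finset V := {v ∈ S | ∃ e ∈ cut (edges G) S, v ∈ e} with hs
  have hscard : #s ≤ 2 := by
    have h1 := sum_card_incident (H := cut (edges G) S) (fun e he => hnd e (cut_subset he)) s
    have h2 : ∑ v ∈ s, 1 ≤ ∑ v ∈ s, #{e ∈ cut (edges G) S | v ∈ e} := by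
      refine sum_le_sum fun v hv => card_pos.2 ?_
      obtain ⟨-, e, he, hve⟩ := mem_filter.1 hv
      exact ⟨e, mem_filter.2 ⟨he, hve⟩⟩
    have h3 : inside (cut (edges G) S) s = ∅ := by
      rw [eq_empty_iff_forall_notMem]
      intro e he
      obtain ⟨hec, hall⟩ := mem_inside.1 he
      obtain ⟨-, -, w, hw, hwS⟩ := mem_cut.1 hec
      exact hwS (mem_filter.1 (hall w hw)).1
    have h4 := card_le_card (cut_subset (H := cut (edges G) S) (S := s))
    rw [h1, h3, card_empty, sum_const, smul_eq_mul] at h2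
    omega
  obtain ⟨a, haS, has⟩ : ∃ a ∈ S, a ∉ s := by
    by_contra! hall
    have h1 := card_le_card (show S ⊆ s from hall)
    have h2 := card_inside_lt hnd hS (h1.trans hscard)
    omega
  obtain ⟨b, hb⟩ := hSc
  rw [mem_compl] at hb
  have hconn := hF.threeConnected (s : Set V) (by rwa [Set.ncard_coe_finset])
  have hbs : b ∉ s := fun h => hb (mem_filter.1 h).1
  obtain ⟨p⟩ := hconn.preconnected ⟨a, by simpa using has⟩ ⟨b, by simpa using hbs⟩
  have hwalk : ∀ (x y : ((s : Set V)ᶜ : Set V)), (G.induce (s : Set V)ᶜ).Walk x y →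
      x.1 ∈ S → y.1 ∈ S := by
    intro x y p
    induction p with
    | nil => exact id
    | @cons x z y hxz p ih =>
      intro hx
      apply ih
      by_contra hz
      have hcut : s(x.1, z.1) ∈ cut (edges G) S :=
        mem_cut.2 ⟨mem_edges.2 (by simpa using hxz), ⟨x.1, by simp, hx⟩, z.1, by simp, hz⟩
      exact x.2 (mem_coe.2 (mem_filter.2 ⟨hx, _, hcut, by simp⟩))
  exact hb (hwalk _ _ p haS)

theorem IsFullerene.isCubicMap (hF : IsFullerene G faces) : IsCubicMap (edges G) faces where
  not_isDiag e he := G.not_isDiag_of_mem_edgeSet (mem_edges.1 he)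
  card_incident v := (card_incident_eq_ncard fun w => by
    rw [mem_edges, SimpleGraph.mem_edgeSet, SimpleGraph.mem_neighborSet]).trans (hF.cubic v)
  face_subset f hf e he := by
    obtain ⟨v, c, -, rfl⟩ := hF.face_cycle f hf
    exact mem_edges.2 (c.edges_subset_edgeSet (List.mem_toFinset.1 he))
  card_faces e he := hF.edge_two_faces e (mem_edges.1 he)
  face_degree f hf v := by
    obtain ⟨u, c, hc, rfl⟩ := hF.face_cycle f hf
    exact card_incident_cycle hc v
  face_split f hf S hdis := by
    obtain ⟨u, c, -, rfl⟩ := hF.face_cycle f hf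
    have hwalk := mem_iff_of_walk c fun e he =>
      Finset.disjoint_left.1 hdis (List.mem_toFinset.2 he)
    have hE : ∀ e ∈ c.edges, e ∈ edges G := fun e he => mem_edges.2 (c.edges_subset_edgeSet he)
    by_cases hu : u ∈ S
    · left
      intro e he
      rw [List.mem_toFinset] at he
      exact mem_inside.2 ⟨hE e he, fun v hv =>
        (hwalk v (mem_support_of_mem_edge he hv)).2 hu⟩
    · right
      intro e he
      rw [List.mem_toFinset] at he
      exact mem_inside.2 ⟨hE e he, fun v hv => mem_compl.2 fun hvS =>
        hu ((hwalk v (mem_support_of_mem_edge he hv)).1 hvS)⟩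
  five_le f hf := by rcases hF.face_size f hf with h | h <;> omega
  le_six f hf := by rcases hF.face_size f hf with h | h <;> omega
  euler := by
    rw [hF.euler, Set.ncard_eq_toFinset_card G.edgeSet]
    rfl
  three_le_cut _ hS hSc := three_le_card_cut hF hS hSc

variable {ring : ZMod 5 → Finset (Sym2 V)} {e : ZMod 5 → Sym2 V} {u w : V} {c : G.Walk u u}
  {c' : G.Walk w w} {S : Finset V}

theorem AreBoundaryCycles.symm (hbd : AreBoundaryCycles 5 ring c c') :
    AreBoundaryCycles 5 ring c' c := by
  obtain ⟨h1, h2, h3, h4, h5⟩ := hbd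
  exact ⟨h2, h1, fun x hx hx' => h3 x hx' hx, fun x => or_comm.trans (h4 x),
    fun x => or_comm.trans (h5 x)⟩

/-- The spokes of the ring separate the two boundary cycles. -/
theorem exists_separating_cut (hF : IsFullerene G faces) (hring : IsFaceRing faces 5 ring)
    (he : ∀ i, ring i ∩ ring (i + 1) = {e i}) (hbd : AreBoundaryCycles 5 ring c c') :
    ∃ S : Finset V, cut (edges G) S = univ.image e ∧ (∀ x ∈ c.support, x ∈ S) ∧
      ∀ x ∈ c'.support, x ∉ S := by
  have h := IsFullerene.isCubicMap hF
  obtain ⟨-, -, -, hsupp, hedge⟩ := hbd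
  obtain ⟨A, hA⟩ := exists_cut_eq_spokes h hring he
  have hspoke : ∀ x ∈ univ.image e, ¬ ∃! i, x ∈ ring i := by
    rintro x hx ⟨k, -, hk⟩
    obtain ⟨i, -, rfl⟩ := mem_image.1 hx
    have hi : e i ∈ ring i ∩ ring (i + 1) := by rw [he]; exact mem_singleton_self _
    rw [mem_inter] at hi
    exact (by decide : ∀ j : ZMod 5, j ≠ j + 1) i ((hk _ hi.1).trans (hk _ hi.2).symm)
  have hc : ∀ x ∈ c.support, x ∈ A ↔ u ∈ A := mem_iff_of_walk c fun x hx hxA =>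
    hspoke x (hA ▸ hxA) ((hedge x).1 (Or.inl hx))
  have hc' : ∀ x ∈ c'.support, x ∈ A ↔ w ∈ A := mem_iff_of_walk c' fun x hx hxA =>
    hspoke x (hA ▸ hxA) ((hedge x).1 (Or.inr hx))
  have huw : ¬ (u ∈ A ↔ w ∈ A) := by
    intro hiff
    have h0 : e 0 ∈ cut (edges G) A := by rw [hA]; exact mem_image_of_mem _ (mem_univ 0)
    have h1 : e 0 ∈ ring 0 ∩ ring (0 + 1) := by rw [he]; exact mem_singleton_self _
    have hmem : ∀ x ∈ e 0, x ∈ A ↔ u ∈ A := by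
      intro x hx
      rcases (hsupp x).2 ⟨0, e 0, (mem_inter.1 h1).1, hx⟩ with h2 | h2
      · exact hc x h2
      · exact (hc' x h2).trans hiff.symm
    obtain ⟨-, ⟨a, ha, haA⟩, b, hb, hbA⟩ := mem_cut.1 h0
    exact hbA ((hmem b hb).2 ((hmem a ha).1 haA))
  by_cases hu : u ∈ A
  · have hw : w ∉ A := fun hw => huw ⟨fun _ => hw, fun _ => hu⟩
    exact ⟨A, hA, fun x hx => (hc x hx).2 hu, fun x hx hxA => hw ((hc' x hx).1 hxA)⟩
  · have hw : w ∈ A := by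
      by_contra hw
      exact huw ⟨fun h => absurd h hu, fun h => absurd h hw⟩
    refine ⟨Aᶜ, by rw [cut_compl, hA], fun x hx => mem_compl.2 fun hxA => hu ((hc x hx).1 hxA),
      fun x hx hxA => mem_compl.1 hxA ((hc' x hx).2 hw)⟩

theorem cutConnected_of_cycle (hF : IsFullerene G faces)
    (he : ∀ i, ring i ∩ ring (i + 1) = {e i}) (hbd : AreBoundaryCycles 5 ring c c')
    (hS : cut (edges G) S = univ.image e) (hc : ∀ x ∈ c.support, x ∈ S)
    (hc' : ∀ x ∈ c'.support, x ∉ S) : CutConnected (inside (edges G) S) S := by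
  refine cutConnected_of_ends (T := c.support.toFinset) (IsFullerene.isCubicMap hF)
    ⟨w, mem_compl.2 (hc' w c'.start_mem_support)⟩ (fun A hdis => ?_) (fun x hx v hv hvS => ?_)
  · have hwalk := mem_iff_of_walk c fun x hx hxA => Finset.disjoint_left.1 hdis hxA
      (mem_inside.2 ⟨mem_edges.2 (c.edges_subset_edgeSet hx),
        fun v hv => hc v (mem_support_of_mem_edge hx hv)⟩)
    by_cases hu : u ∈ A
    · exact Or.inl fun x hx => (hwalk x (List.mem_toFinset.1 hx)).2 hu
    · exact Or.inr fun x hx => mem_compl.2 fun hxA =>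
        hu ((hwalk x (List.mem_toFinset.1 hx)).1 hxA)
  · rw [hS] at hx
    obtain ⟨i, -, rfl⟩ := mem_image.1 hx
    have hi : e i ∈ ring i ∩ ring (i + 1) := by rw [he]; exact mem_singleton_self _
    rcases (hbd.2.2.2.1 v).2 ⟨i, e i, (mem_inter.1 hi).1, hv⟩ with h1 | h1
    · exact List.mem_toFinset.2 h1
    · exact absurd hvS (hc' v h1)

theorem rim_eq_edges (hF : IsFullerene G faces) (hring : IsFaceRing faces 5 ring)
    (he : ∀ i, ring i ∩ ring (i + 1) = {e i}) (hbd : AreBoundaryCycles 5 ring c c')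
    (hS : cut (edges G) S = univ.image e) (hc : ∀ x ∈ c.support, x ∈ S)
    (hc' : ∀ x ∈ c'.support, x ∉ S) : rim (edges G) faces S = c.edges.toFinset := by
  ext x
  rw [mem_rim, crossing_eq_image_ring (IsFullerene.isCubicMap hF) hring he hS, List.mem_toFinset]
  constructor
  · rintro ⟨hxS, f, hf, hxf⟩
    obtain ⟨i, -, rfl⟩ := mem_image.1 hf
    have huniq : ∃! i, x ∈ ring i := by
      refine ⟨i, hxf, fun j hxj => ?_⟩
      by_contra hne
      have := mem_image_of_mem_ring hring he hne hxj hxf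
      rw [← hS] at this
      exact Finset.disjoint_left.1 disjoint_inside_cut hxS this
    rcases (hbd.2.2.2.2 x).2 huniq with h1 | h1
    · exact h1
    · obtain ⟨v, hv⟩ := exists_mem_sym2 x
      exact absurd ((mem_inside.1 hxS).2 v hv) (hc' v (mem_support_of_mem_edge h1 hv))
  · intro hx
    obtain ⟨i, hi, -⟩ := (hbd.2.2.2.2 x).1 (Or.inl hx)
    exact ⟨mem_inside.2 ⟨mem_edges.2 (c.edges_subset_edgeSet hx),
      fun v hv => hc v (mem_support_of_mem_edge hx hv)⟩, ring i,
      mem_image_of_mem _ (mem_univ i), hi⟩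

end Graph

end FaceRing

/-- for a ring of five faces in a fullerene graph with inner cycle `C`
and outer cycle `C'`, either `C` or `C'` bounds a face, or both have length 10 and
all five faces of the ring are hexagons. -/
theorem ring_of_five_faces {V : Type*} [Fintype V] [DecidableEq V]
    (G : SimpleGraph V) (faces : Finset (Finset (Sym2 V)))
    (hF : IsFullerene G faces)
    (ring : ZMod 5 → Finset (Sym2 V)) (hring : IsFaceRing faces 5 ring)
    (u w : V) (c : G.Walk u u) (c' : G.Walk w w)
    (hbd : AreBoundaryCycles 5 ring c c') :
    (c.edges.toFinset ∈ faces ∨ c'.edges.toFinset ∈ faces) ∨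
    (c.length = 10 ∧ c'.length = 10 ∧ ∀ i, (ring i).card = 6) := by
  classical
  have h := FaceRing.IsFullerene.isCubicMap hF
  choose e he using hring.2.2.2.1
  obtain ⟨S, hS, hc, hc'⟩ := FaceRing.exists_separating_cut hF hring he hbd
  have hS' : FaceRing.cut (FaceRing.edges G) Sᶜ = Finset.univ.image e := by
    rw [FaceRing.cut_compl, hS]
  have hcSc : ∀ x ∈ c.support, x ∉ Sᶜ := fun x hx hxS => Finset.mem_compl.1 hxS (hc x hx)
  have hcSc' : ∀ x ∈ c'.support, x ∈ Sᶜ := fun x hx => Finset.mem_compl.2 (hc' x hx)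
  have hbd' := FaceRing.AreBoundaryCycles.symm hbd
  have hb : FaceRing.IsBond (FaceRing.edges G) S :=
    ⟨⟨u, hc u c.start_mem_support⟩, ⟨w, hcSc' w c'.start_mem_support⟩,
      FaceRing.cutConnected_of_cycle hF he hbd hS hc hc',
      FaceRing.cutConnected_of_cycle hF he hbd' hS' hcSc' hcSc⟩
  have ht := FaceRing.isThinSide_of_ring h hring he hS
  have ht' := FaceRing.isThinSide_of_ring h hring he hS'
  have hrim := FaceRing.rim_eq_edges hF hring he hbd hS hc hc'
  have hrim' := FaceRing.rim_eq_edges hF hring he hbd' hS' hcSc' hcSc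
  have hcard : (FaceRing.cut (FaceRing.edges G) S).card = 5 := by
    rw [hS, Finset.card_image_of_injective _ (FaceRing.injective_spokes hring he)]
    rfl
  have hlen : (FaceRing.rim (FaceRing.edges G) faces S).card = c.length := by
    rw [hrim, List.toFinset_card_of_nodup hbd.1.edges_nodup, c.length_edges]
  have hlen' : (FaceRing.rim (FaceRing.edges G) faces Sᶜ).card = c'.length := by
    rw [hrim', List.toFinset_card_of_nodup hbd.2.1.edges_nodup, c'.length_edges]
  by_cases h9 : c.length ≤ 9
  · left; left
    rw [← hrim]
    exact h.rim_mem_faces hb ht hcard (hlen ▸ h9)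
  by_cases h9' : c'.length ≤ 9
  · left; right
    rw [← hrim']
    exact h.rim_mem_faces hb.compl ht' (by rw [FaceRing.cut_compl, hcard]) (hlen' ▸ h9')
  right
  have hsum := h.sum_card_crossing ht ht'
  rw [FaceRing.crossing_eq_image_ring h hring he hS,
    Finset.sum_image fun i _ j _ hij => hring.2.1 hij, hlen, hlen', hcard] at hsum
  have hle : ∀ i ∈ Finset.univ, (ring i).card ≤ 6 := fun i _ => h.le_six _ (hring.2.2.1 i)
  have hsix : ∑ _i : ZMod 5, 6 = 30 := rfl
  have hsum_le := Finset.sum_le_sum hle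
  refine ⟨by omega, by omega, fun i => ?_⟩
  exact (Finset.sum_eq_sum_iff_of_le hle).1 (by omega) i (Finset.mem_univ i)
end

section
/- If a fullerene graph F contains a pentagonal ring of length five, then that ring is isomorphic to R_5, i.e., its inner or outer cycle bounds a pentagonal face of F. -/
open SimpleGraph

/-- A pentagonal ring of length `l`: a cyclic sequence of pentagonal faces,
consecutive faces sharing exactly one edge, non-consecutive faces vertex-disjoint,
and the shared edges forming a matching. -/
def IsPentagonalRing [DecidableEq V] (faces : Finset (Finset (Sym2 V)))
    (l : ℕ) (ring : ZMod l → Finset (Sym2 V)) : Prop :=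
  3 ≤ l ∧ Function.Injective ring ∧
  (∀ i, ring i ∈ faces ∧ (ring i).card = 5) ∧
  (∀ i, ∃ e, ring i ∩ ring (i + 1) = {e}) ∧
  (∀ i j : ZMod l, j ≠ i → j ≠ i + 1 → j ≠ i - 1 →
    Disjoint (faceVerts (ring i)) (faceVerts (ring j))) ∧
  (∀ i j : ZMod l, i ≠ j → ∀ e ∈ ring i ∩ ring (i + 1), ∀ e' ∈ ring j ∩ ring (j + 1),
    ∀ v : V, v ∈ e → v ∉ e')
theorem mem_faceVerts_left {V : Type*} {f : Finset (Sym2 V)} {v w : V} (h : s(v, w) ∈ f) :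
    v ∈ faceVerts f := ⟨_, h, Sym2.mem_mk_left _ _⟩

theorem mem_faceVerts_right {V : Type*} {f : Finset (Sym2 V)} {v w : V} (h : s(v, w) ∈ f) :
    w ∈ faceVerts f := ⟨_, h, Sym2.mem_mk_right _ _⟩

theorem mem_of_closed_of_connected {V : Type*} {G : SimpleGraph V} {P A : Set V}
    (hconn : (G.induce Pᶜ).Connected)
    (hA : ∀ v ∈ A, v ∉ P → ∀ w, G.Adj v w → w ∈ A ∨ w ∈ P) {a b : V} (ha : a ∈ A) (haP : a ∉ P)
    (hbP : b ∉ P) : b ∈ A := by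
  obtain ⟨q⟩ := hconn.preconnected ⟨a, haP⟩ ⟨b, hbP⟩
  have key : ∀ (x y : (Pᶜ : Set V)), (G.induce Pᶜ).Walk x y → x.1 ∈ A → y.1 ∈ A := by
    intro x y q
    induction q with
    | nil => exact id
    | @cons x y _ h _ ih =>
      intro hx
      exact ih ((hA x.1 hx x.2 y.1 h).resolve_right y.2)
  exact key _ _ q ha

theorem exists_pentagon_labelling {V : Type*} {G : SimpleGraph V} {u : V} {c : G.Walk u u}
    (hc : c.IsCycle) (hlen : c.length = 5)
    {e e' : Sym2 V} (he : e ∈ c.edges) (he' : e' ∈ c.edges) (hdisj : ∀ v ∈ e, v ∉ e') :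
    ∃ a b a' b' p : V, e = s(a, b) ∧ e' = s(a', b') ∧ s(b, b') ∈ c.edges ∧ s(a', p) ∈ c.edges ∧
      s(p, a) ∈ c.edges ∧ p ≠ b ∧ p ≠ b' ∧
      ∀ x ∈ c.support, x = a ∨ x = b ∨ x = a' ∨ x = b' ∨ x = p := by
  match c, hlen with
  | .cons (v := v₁) _ (.cons (v := v₂) _ (.cons (v := v₃) _ (.cons (v := v₄) _ (.cons _ .nil)))),
      _ =>
    have hnd := hc.support_nodup
    simp only [Walk.support_cons, Walk.support_nil, List.tail_cons, List.nodup_cons,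
      List.mem_cons, List.not_mem_nil, or_false, not_or] at hnd
    simp only [Walk.edges_cons, Walk.edges_nil, List.mem_cons, List.not_mem_nil, or_false]
      at he he' ⊢
    simp only [Walk.support_cons, Walk.support_nil, List.mem_cons, List.not_mem_nil, or_false]
    obtain ⟨⟨h12, h13, h14, h1u⟩, ⟨h23, h24, h2u⟩, ⟨h34, h3u⟩, h4u, -⟩ := hnd
    rcases he with rfl | rfl | rfl | rfl | rfl <;> rcases he' with rfl | rfl | rfl | rfl | rfl <;>
      simp only [Sym2.mem_iff, forall_eq_or_imp, forall_eq, not_or, not_true_eq_false,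
        false_and, and_false] at hdisj
    · exact ⟨u, v₁, v₃, v₂, v₄, by simp only [Sym2.eq_iff]; grind⟩
    · exact ⟨v₁, u, v₃, v₄, v₂, by simp only [Sym2.eq_iff]; grind⟩
    · exact ⟨v₁, v₂, v₄, v₃, u, by simp only [Sym2.eq_iff]; grind⟩
    · exact ⟨v₂, v₁, v₄, u, v₃, by simp only [Sym2.eq_iff]; grind⟩
    · exact ⟨v₃, v₂, u, v₁, v₄, by simp only [Sym2.eq_iff]; grind⟩
    · exact ⟨v₂, v₃, u, v₄, v₁, by simp only [Sym2.eq_iff]; grind⟩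
    · exact ⟨v₃, v₄, v₁, u, v₂, by simp only [Sym2.eq_iff]; grind⟩
    · exact ⟨v₄, v₃, v₁, v₂, u, by simp only [Sym2.eq_iff]; grind⟩
    · exact ⟨v₄, u, v₂, v₁, v₃, by simp only [Sym2.eq_iff]; grind⟩
    · exact ⟨u, v₄, v₂, v₃, v₁, by simp only [Sym2.eq_iff]; grind⟩

section Ring

variable {V : Type*} [DecidableEq V] {G : SimpleGraph V}
  {faces : Finset (Finset (Sym2 V))}

theorem AreBoundaryCycles.symm {u w : V} {l : ℕ} {ring : ZMod l → Finset (Sym2 V)}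
    {c : G.Walk u u} {c' : G.Walk w w} (h : AreBoundaryCycles l ring c c') :
    AreBoundaryCycles l ring c' c := by
  obtain ⟨h1, h2, h3, h4, h5⟩ := h
  exact ⟨h2, h1, fun x hx hx' => h3 x hx' hx, fun x => by rw [or_comm, h4],
    fun e => by rw [or_comm, h5]⟩

variable {ring : ZMod 5 → Finset (Sym2 V)} {u w : V} {c : G.Walk u u} {c' : G.Walk w w}

/-- A ring edge other than the two spokes of its pentagon lies on no other pentagon. -/
theorem existsUnique_of_not_spoke (hring : IsPentagonalRing faces 5 ring) {e : ZMod 5 → Sym2 V}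
    (he : ∀ i, ring i ∩ ring (i + 1) = {e i}) {i : ZMod 5} {d : Sym2 V} (hd : d ∈ ring i)
    (h1 : d ≠ e (i - 1)) (h2 : d ≠ e i) : ∃! j, d ∈ ring j := by
  refine ⟨i, hd, fun j hj => ?_⟩
  by_contra hji
  by_cases hj1 : j = i + 1
  · subst hj1
    have : d ∈ ring i ∩ ring (i + 1) := Finset.mem_inter.2 ⟨hd, hj⟩
    rw [he] at this
    exact h2 (Finset.mem_singleton.1 this)
  by_cases hj2 : j = i - 1
  · subst hj2
    have : d ∈ ring (i - 1) ∩ ring (i - 1 + 1) := Finset.mem_inter.2 ⟨hj, by simpa using hd⟩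
    rw [he] at this
    exact h1 (Finset.mem_singleton.1 this)
  have := hring.2.2.2.2.1 i j hji hj1 hj2
  induction d with | _ a b =>
  exact Set.disjoint_left.1 this (mem_faceVerts_left hd) (mem_faceVerts_left hj)

theorem mem_support_of_existsUnique (hbd : AreBoundaryCycles 5 ring c c') {a b : V}
    (h : ∃! i, s(a, b) ∈ ring i) (ha : a ∈ c.support) :
    s(a, b) ∈ c.edges ∧ b ∈ c.support := by
  rcases (hbd.2.2.2.2 _).2 h with h | h
  · exact ⟨h, c.snd_mem_support_of_mem_edges h⟩
  · exact absurd (c'.fst_mem_support_of_mem_edges h) (hbd.2.2.1 a ha)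

theorem card_edges_le_card_support (hc : c.IsCycle) :
    c.edges.toFinset.card ≤ c.support.toFinset.card := by
  have h : c.support.tail.toFinset ⊆ c.support.toFinset := fun v hv =>
    List.mem_toFinset.2 (List.mem_of_mem_tail (List.mem_toFinset.1 hv))
  refine le_trans ?_ (Finset.card_le_card h)
  rw [List.toFinset_card_of_nodup hc.edges_nodup, List.toFinset_card_of_nodup hc.support_nodup]
  simp

end Ring

section Helpers

variable {V : Type*} [Fintype V] [DecidableEq V] {G : SimpleGraph V}
  {faces : Finset (Finset (Sym2 V))} {ring : ZMod 5 → Finset (Sym2 V)}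
  {u w : V} {c : G.Walk u u} {c' : G.Walk w w}

/-- The vertices joined to `v` by an edge of `f`. -/
def nbrsIn (f : Finset (Sym2 V)) (v : V) : Finset V := Finset.univ.filter fun w => s(v, w) ∈ f

theorem mem_nbrsIn {f : Finset (Sym2 V)} {v w : V} : w ∈ nbrsIn f v ↔ s(v, w) ∈ f := by
  simp [nbrsIn]

theorem card_nbrsIn_of_isCycle {u : V} {c : G.Walk u u} (hc : c.IsCycle) {v : V}
    (hv : v ∈ c.support) : (nbrsIn c.edges.toFinset v).card = 2 := by
  rw [← hc.ncard_neighborSet_toSubgraph_eq_two hv, ← Set.ncard_coe_finset]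
  congr 1
  ext w
  rw [Finset.mem_coe, mem_nbrsIn, List.mem_toFinset, Subgraph.mem_neighborSet,
    ← Subgraph.mem_edgeSet, Walk.mem_edges_toSubgraph]

theorem card_nbrsIn_of_mem_faceVerts (hF : IsFullerene G faces) {f : Finset (Sym2 V)}
    (hf : f ∈ faces) {v : V} (hv : v ∈ faceVerts f) : (nbrsIn f v).card = 2 := by
  obtain ⟨x, c, hc, rfl⟩ := hF.face_cycle f hf
  obtain ⟨e, he, hve⟩ := hv
  refine card_nbrsIn_of_isCycle hc ?_
  exact Walk.mem_support_of_mem_edges (List.mem_toFinset.1 he) hve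

theorem face_subset_edgeSet (hF : IsFullerene G faces) {f : Finset (Sym2 V)}
    (hf : f ∈ faces) {e : Sym2 V} (he : e ∈ f) : e ∈ G.edgeSet := by
  obtain ⟨x, c, hc, rfl⟩ := hF.face_cycle f hf
  exact c.edges_subset_edgeSet (List.mem_toFinset.1 he)

theorem exists_two_faces (hF : IsFullerene G faces) {e : Sym2 V} (he : e ∈ G.edgeSet) :
    ∃ f ∈ faces, ∃ g ∈ faces, f ≠ g ∧ e ∈ f ∧ e ∈ g := by
  obtain ⟨f, g, hfg, h⟩ := Finset.card_eq_two.1 (hF.edge_two_faces e he)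
  have hf : f ∈ faces.filter (e ∈ ·) := by rw [h]; simp
  have hg : g ∈ faces.filter (e ∈ ·) := by rw [h]; simp
  rw [Finset.mem_filter] at hf hg
  exact ⟨f, hf.1, g, hg.1, hfg, hf.2, hg.2⟩

theorem filter_mem_eq_pair (hF : IsFullerene G faces) {e : Sym2 V} {f g : Finset (Sym2 V)}
    (hf : f ∈ faces) (hg : g ∈ faces) (hfg : f ≠ g) (hef : e ∈ f) (heg : e ∈ g) :
    faces.filter (e ∈ ·) = {f, g} := by
  symm
  apply Finset.eq_of_subset_of_card_le
  · intro x hx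
    simp only [Finset.mem_insert, Finset.mem_singleton] at hx
    rcases hx with rfl | rfl <;> simp [*]
  · rw [hF.edge_two_faces e (face_subset_edgeSet hF hf hef), Finset.card_pair hfg]

/-- In a cubic graph, two sets of edges of degree two at `v` have a common edge at `v`. -/
theorem exists_common_edge (hcubic : ∀ v : V, (G.neighborSet v).ncard = 3)
    {f g : Finset (Sym2 V)} (hf : ∀ e ∈ f, e ∈ G.edgeSet) (hg : ∀ e ∈ g, e ∈ G.edgeSet) {v : V}
    (hvf : (nbrsIn f v).card = 2) (hvg : (nbrsIn g v).card = 2) :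
    ∃ w, s(v, w) ∈ f ∧ s(v, w) ∈ g := by
  have hsub : (((nbrsIn f v ∪ nbrsIn g v : Finset V) : Set V)) ⊆ G.neighborSet v := by
    intro w hw
    simp only [Finset.coe_union, Set.mem_union, Finset.mem_coe, mem_nbrsIn] at hw
    exact hw.elim (hf _) (hg _)
  have h3 := Set.ncard_le_ncard hsub (Set.toFinite _)
  rw [Set.ncard_coe_finset, hcubic] at h3
  have := Finset.card_union_add_card_inter (nbrsIn f v) (nbrsIn g v)
  obtain ⟨w, hw⟩ := Finset.card_pos.1 (show 0 < (nbrsIn f v ∩ nbrsIn g v).card by omega)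
  simp only [Finset.mem_inter, mem_nbrsIn] at hw
  exact ⟨w, hw⟩

/-- In a cubic graph, the edge at `v` outside an edge set of degree two at `v` is unique. -/
theorem eq_of_not_mem (hcubic : ∀ v : V, (G.neighborSet v).ncard = 3)
    {f : Finset (Sym2 V)} (hf : ∀ e ∈ f, e ∈ G.edgeSet) {v : V}
    (hvf : (nbrsIn f v).card = 2) {a b : V} (ha : G.Adj v a) (hb : G.Adj v b)
    (haf : s(v, a) ∉ f) (hbf : s(v, b) ∉ f) : a = b := by
  by_contra hab
  have hsub : ((({a, b} ∪ nbrsIn f v : Finset V) : Set V)) ⊆ G.neighborSet v := by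
    intro w hw
    simp only [Finset.coe_union, Set.mem_union, Finset.mem_coe, mem_nbrsIn, Finset.mem_insert,
      Finset.mem_singleton] at hw
    rcases hw with (rfl | rfl) | hw
    exacts [ha, hb, hf _ hw]
  have h3 := Set.ncard_le_ncard hsub (Set.toFinite _)
  rw [Set.ncard_coe_finset, hcubic, Finset.card_union_of_disjoint, Finset.card_pair hab] at h3
  · omega
  · simp [mem_nbrsIn, haf, hbf]

theorem exists_not_mem (hcubic : ∀ v : V, (G.neighborSet v).ncard = 3)
    {f : Finset (Sym2 V)} {v : V} (hvf : (nbrsIn f v).card = 2) :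
    ∃ a, G.Adj v a ∧ s(v, a) ∉ f := by
  by_contra! h
  have hsub : G.neighborSet v ⊆ (nbrsIn f v : Finset V) := fun w hw => by
    simpa [mem_nbrsIn] using h w hw
  have h3 := Set.ncard_le_ncard hsub (Set.toFinite _)
  rw [Set.ncard_coe_finset, hcubic] at h3
  omega

theorem exists_mem_face (hF : IsFullerene G faces) (v : V) : ∃ f ∈ faces, v ∈ faceVerts f := by
  have h : (G.neighborSet v).Nonempty := by
    rw [← Set.ncard_pos (Set.toFinite _), hF.cubic]; norm_num
  obtain ⟨w, hw⟩ := h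
  obtain ⟨f, hf, g, hg, hfg, hef, heg⟩ := exists_two_faces hF (e := s(v, w)) hw
  exact ⟨f, hf, mem_faceVerts_left hef⟩

theorem exists_shared_edge (hF : IsFullerene G faces) {f g : Finset (Sym2 V)} (hf : f ∈ faces)
    (hg : g ∈ faces) {v : V} (hvf : v ∈ faceVerts f) (hvg : v ∈ faceVerts g) :
    ∃ w, s(v, w) ∈ f ∧ s(v, w) ∈ g :=
  exists_common_edge hF.cubic (fun _ => face_subset_edgeSet hF hf)
    (fun _ => face_subset_edgeSet hF hg) (card_nbrsIn_of_mem_faceVerts hF hf hvf)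
    (card_nbrsIn_of_mem_faceVerts hF hg hvg)

/-- A property of faces that is passed between adjacent faces holds for all faces or none. -/
theorem face_induction (hF : IsFullerene G faces) (p : Finset (Sym2 V) → Prop)
    (hp : ∀ f ∈ faces, ∀ g ∈ faces, ∀ e ∈ f, e ∈ g → p f → p g) {f g : Finset (Sym2 V)}
    (hf : f ∈ faces) (hg : g ∈ faces) (h : p f) : p g := by
  have nonempty_face : ∀ f ∈ faces, ∃ v, v ∈ faceVerts f := by
    intro f hf
    have : 0 < f.card := by rcases hF.face_size f hf with h | h <;> omega
    obtain ⟨e, he⟩ := Finset.card_pos.1 this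
    induction e with | _ a b => exact ⟨a, mem_faceVerts_left he⟩
  obtain ⟨a, ha⟩ := nonempty_face f hf
  obtain ⟨b, hb⟩ := nonempty_face g hg
  have step : ∀ v, ∀ f ∈ faces, ∀ g ∈ faces, v ∈ faceVerts f → v ∈ faceVerts g → p f → p g := by
    intro v f hf g hg hvf hvg h
    obtain ⟨w, h1, h2⟩ := exists_shared_edge hF hf hg hvf hvg
    exact hp f hf g hg _ h1 h2 h
  have hbA : b ∈ {v : V | ∃ f ∈ faces, v ∈ faceVerts f ∧ p f} := by
    refine mem_of_closed_of_connected (P := ∅) (hF.threeConnected ∅ (by simp)) ?_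
      (a := a) ⟨f, hf, ha, h⟩ (by simp) (by simp)
    rintro v ⟨f, hf, hvf, hpf⟩ - w hvw
    left
    obtain ⟨f', hf', -, -, -, hef, -⟩ := exists_two_faces hF (e := s(v, w)) hvw
    exact ⟨f', hf', mem_faceVerts_right hef, step v f hf f' hf' hvf (mem_faceVerts_left hef) hpf⟩
  obtain ⟨f', hf', hbf', hpf'⟩ := hbA
  exact step b f' hf' g hg hbf' hb hpf'

theorem card_incident_eq_card_nbrsIn [Fintype G.edgeSet] {C : Finset (Sym2 V)}
    (hC : ∀ e ∈ C, e ∈ G.edgeSet) (v : V) :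
    (Finset.univ.filter fun e : G.edgeSet => v ∈ e.1 ∧ e.1 ∈ C).card = (nbrsIn C v).card := by
  symm
  refine Finset.card_bij (fun w hw => ⟨s(v, w), hC _ (mem_nbrsIn.1 hw)⟩) ?_ ?_ ?_
  · intro w hw
    simpa using mem_nbrsIn.1 hw
  · intro a ha b hb hab
    exact Sym2.congr_right.1 (congrArg Subtype.val hab)
  · rintro ⟨e, he⟩ h
    simp only [Finset.mem_filter, Finset.mem_univ, true_and] at h
    obtain ⟨w, rfl⟩ := h.1
    exact ⟨w, mem_nbrsIn.2 h.2, rfl⟩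

theorem card_nbrsIn_cast_eq_zero {f : Finset (Sym2 V)}
    (h : ∀ v ∈ faceVerts f, (nbrsIn f v).card = 2) (v : V) :
    ((nbrsIn f v).card : ZMod 2) = 0 := by
  by_cases hv : v ∈ faceVerts f
  · rw [h v hv]; rfl
  · rw [show nbrsIn f v = ∅ from Finset.eq_empty_of_forall_notMem fun w hw =>
      hv (mem_faceVerts_left (mem_nbrsIn.1 hw))]
    simp

/-- Jordan curve theorem for fullerenes: a two-regular edge set `C` splits the faces into two
classes, and crossing an edge changes the class exactly when the edge is in `C`. -/
theorem exists_side (hF : IsFullerene G faces) {C : Finset (Sym2 V)}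
    (hC : ∀ e ∈ C, e ∈ G.edgeSet) (hC2 : ∀ v ∈ faceVerts C, (nbrsIn C v).card = 2) :
    ∃ x : Finset (Sym2 V) → ZMod 2, ∀ f ∈ faces, ∀ g ∈ faces, f ≠ g → ∀ e ∈ f, e ∈ g →
      x f + x g = if e ∈ C then 1 else 0 := by
  classical
  let M : Matrix V G.edgeSet (ZMod 2) :=
    Matrix.of fun v e => if v ∈ e.1 then 1 else 0
  let N : Matrix G.edgeSet faces (ZMod 2) :=
    Matrix.of fun e f => if e.1 ∈ f.1 then 1 else 0
  have hdot : ∀ D : Finset (Sym2 V), (∀ e ∈ D, e ∈ G.edgeSet) →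
      (∀ v ∈ faceVerts D, (nbrsIn D v).card = 2) → ∀ v,
      ∑ e : G.edgeSet, M v e * (if e.1 ∈ D then 1 else 0) = 0 := by
    intro D hD hD2 v
    refine Eq.trans ?_ (card_nbrsIn_cast_eq_zero hD2 v)
    rw [← card_incident_eq_card_nbrsIn hD v,
      Finset.card_filter]
    push_cast
    refine Finset.sum_congr rfl fun e _ => ?_
    by_cases h1 : v ∈ e.1 <;> by_cases h2 : e.1 ∈ D <;> simp [M, h1, h2]
  have hN : ∀ (x : faces → ZMod 2) (f g : faces), f ≠ g → ∀ e : G.edgeSet, e.1 ∈ f.1 →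
      e.1 ∈ g.1 → (N.mulVec x) e = x f + x g := by
    intro x f g hfg e hef heg
    have hpair : Finset.univ.filter (fun h : faces => e.1 ∈ h.1) = {f, g} := by
      have := filter_mem_eq_pair hF f.2 g.2 (fun h => hfg (Subtype.ext h)) hef heg
      ext h
      have h' := Finset.ext_iff.1 this h.1
      simp only [Finset.mem_filter, h.2, true_and, Finset.mem_insert, Finset.mem_singleton] at h'
      simp only [Finset.mem_filter, Finset.mem_univ, true_and, h', Finset.mem_insert,
        Finset.mem_singleton, Subtype.ext_iff]
    simp only [Matrix.mulVec, dotProduct, N, Matrix.of_apply, ite_mul, one_mul, zero_mul]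
    rw [← Finset.sum_filter, hpair, Finset.sum_pair hfg]
  have hM : ∀ (y : V → ZMod 2) (a b : V) (h : G.Adj a b),
      (M.transpose.mulVec y) ⟨s(a, b), h⟩ = y a + y b := by
    intro y a b h
    have hpair : Finset.univ.filter (fun v : V => v ∈ s(a, b)) = {a, b} := by
      ext v; simp
    simp only [Matrix.mulVec, dotProduct, M, Matrix.transpose_apply, Matrix.of_apply,
      ite_mul, one_mul, zero_mul]
    rw [← Finset.sum_filter, hpair, Finset.sum_pair h.ne]
  have hkerM : Module.finrank (ZMod 2) (LinearMap.ker M.transpose.mulVecLin) ≤ 1 := by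
    have hmem : (fun _ => 1 : V → ZMod 2) ∈ LinearMap.ker M.transpose.mulVecLin := by
      rw [LinearMap.mem_ker, Matrix.mulVecLin_apply]
      ext ⟨e, he⟩
      induction e with | _ a b => exact (hM _ a b he).trans (CharTwo.add_self_eq_zero 1)
    refine finrank_le_one ⟨_, hmem⟩ fun y => ?_
    obtain ⟨a⟩ : Nonempty V := Fintype.card_pos_iff.1 (by have := hF.card_ge; omega)
    refine ⟨y.1 a, Subtype.ext (funext fun b => ?_)⟩
    have hy := y.2
    rw [LinearMap.mem_ker, Matrix.mulVecLin_apply] at hy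
    have : b ∈ {v : V | y.1 a = y.1 v} := by
      refine mem_of_closed_of_connected (P := ∅) (hF.threeConnected ∅ (by simp)) ?_
        (a := a) rfl (by simp) (by simp)
      intro v hv _ w hvw
      have h := hM y.1 v w hvw
      rw [hy, Pi.zero_apply] at h
      left
      exact (show y.1 a = y.1 v from hv).trans (CharTwo.add_eq_zero.1 h.symm)
    simpa using this
  have hkerN : Module.finrank (ZMod 2) (LinearMap.ker N.mulVecLin) ≤ 1 := by
    have hmem : (fun _ => 1 : faces → ZMod 2) ∈ LinearMap.ker N.mulVecLin := by
      rw [LinearMap.mem_ker, Matrix.mulVecLin_apply]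
      ext ⟨e, he⟩
      obtain ⟨f, hf, g, hg, hfg, hef, heg⟩ := exists_two_faces hF he
      rw [hN _ ⟨f, hf⟩ ⟨g, hg⟩ (by simpa using hfg) _ hef heg]
      exact CharTwo.add_self_eq_zero 1
    refine finrank_le_one ⟨_, hmem⟩ fun x => ?_
    obtain ⟨a⟩ : Nonempty V := Fintype.card_pos_iff.1 (by have := hF.card_ge; omega)
    obtain ⟨f₀, hf₀, -⟩ := exists_mem_face hF a
    refine ⟨x.1 ⟨f₀, hf₀⟩, Subtype.ext (funext fun b => ?_)⟩
    have hx := x.2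
    rw [LinearMap.mem_ker, Matrix.mulVecLin_apply] at hx
    have : ∃ h : b.1 ∈ faces, x.1 ⟨f₀, hf₀⟩ = x.1 ⟨b.1, h⟩ := by
      refine face_induction hF (fun f => ∃ h : f ∈ faces, x.1 ⟨f₀, hf₀⟩ = x.1 ⟨f, h⟩) ?_
        hf₀ b.2 ⟨hf₀, rfl⟩
      rintro f hf g hg e hef heg ⟨_, h⟩
      refine ⟨hg, ?_⟩
      by_cases hfg : f = g
      · subst hfg; exact h
      have h2 := hN x.1 ⟨f, hf⟩ ⟨g, hg⟩ (by simpa using hfg)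
        ⟨e, face_subset_edgeSet hF hf hef⟩ hef heg
      rw [hx, Pi.zero_apply] at h2
      exact h.trans (CharTwo.add_eq_zero.1 h2.symm)
    obtain ⟨_, h⟩ := this
    simpa using h
  have hle : LinearMap.range N.mulVecLin ≤ LinearMap.ker M.mulVecLin := by
    rintro _ ⟨x, rfl⟩
    rw [LinearMap.mem_ker, Matrix.mulVecLin_apply, Matrix.mulVecLin_apply, Matrix.mulVec_mulVec]
    have : M * N = 0 := by
      ext v f
      exact hdot f.1 (fun _ => face_subset_edgeSet hF f.2)
        (fun _ => card_nbrsIn_of_mem_faceVerts hF f.2) v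
    rw [this, Matrix.zero_mulVec]
  have heq : LinearMap.range N.mulVecLin = LinearMap.ker M.mulVecLin := by
    refine Submodule.eq_of_le_of_finrank_le hle ?_
    have h1 := LinearMap.finrank_range_add_finrank_ker N.mulVecLin
    have h2 := LinearMap.finrank_range_add_finrank_ker M.mulVecLin
    have h3 := LinearMap.finrank_range_add_finrank_ker M.transpose.mulVecLin
    have h4 : Module.finrank (ZMod 2) (LinearMap.range M.transpose.mulVecLin) =
      Module.finrank (ZMod 2) (LinearMap.range M.mulVecLin) := Matrix.rank_transpose M
    have h5 := hF.euler
    rw [← Nat.card_coe_set_eq, Nat.card_eq_fintype_card] at h5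
    simp only [Module.finrank_fintype_fun_eq_card, Fintype.card_coe] at h1 h2 h3
    omega
  have hCker : (fun e : G.edgeSet => if e.1 ∈ C then (1 : ZMod 2) else 0) ∈
      LinearMap.ker M.mulVecLin := by
    rw [LinearMap.mem_ker, Matrix.mulVecLin_apply]
    exact funext (hdot C hC hC2)
  rw [← heq] at hCker
  obtain ⟨x, hx⟩ := hCker
  refine ⟨fun f => if h : f ∈ faces then x ⟨f, h⟩ else 0, fun f hf g hg hfg e hef heg => ?_⟩
  have := hN x ⟨f, hf⟩ ⟨g, hg⟩ (by simpa using hfg) ⟨e, face_subset_edgeSet hF hf hef⟩ hef heg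
  rw [Matrix.mulVecLin_apply] at hx
  rw [hx] at this
  simp [hf, hg, ← this]

theorem exists_ring_face_labelling (hF : IsFullerene G faces)
    (hring : IsPentagonalRing faces 5 ring) {e : ZMod 5 → Sym2 V}
    (he : ∀ i, ring i ∩ ring (i + 1) = {e i}) (i : ZMod 5) :
    ∃ a b a' b' p : V, e (i - 1) = s(a, b) ∧ e i = s(a', b') ∧
      (∃! j, s(b, b') ∈ ring j) ∧ (∃! j, s(a', p) ∈ ring j) ∧ (∃! j, s(p, a) ∈ ring j) ∧
      ∀ x ∈ faceVerts (ring i), x = a ∨ x = b ∨ x = a' ∨ x = b' ∨ x = p := by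
  obtain ⟨v, q, hq, hqe⟩ := hF.face_cycle _ (hring.2.2.1 i).1
  have hlen : q.length = 5 := by
    rw [← Walk.length_edges, ← List.toFinset_card_of_nodup hq.edges_nodup, hqe]
    exact (hring.2.2.1 i).2
  have hmem : ∀ j, e j ∈ ring j ∩ ring (j + 1) := fun j => by rw [he]; simp
  have h1 : e (i - 1) ∈ ring i := by simpa using (Finset.mem_inter.1 (hmem (i - 1))).2
  have h2 : e i ∈ ring i := (Finset.mem_inter.1 (hmem i)).1
  have hdisj := hring.2.2.2.2.2 (i - 1) i (by rw [Ne, sub_eq_self]; decide) _ (hmem (i - 1)) _ (hmem i)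
  have hq' : ∀ d, d ∈ q.edges ↔ d ∈ ring i := fun d => by rw [← hqe, List.mem_toFinset]
  obtain ⟨a, b, a', b', p, h3, h4, h5, h6, h7, h8, h9, h10⟩ :=
    exists_pentagon_labelling hq hlen ((hq' _).2 h1) ((hq' _).2 h2) hdisj
  rw [hq'] at h5 h6 h7
  rw [h3, h4] at hdisj
  simp only [Sym2.mem_iff, forall_eq_or_imp, forall_eq, not_or] at hdisj
  obtain ⟨⟨haa', hab'⟩, hba', hbb'⟩ := hdisj
  refine ⟨a, b, a', b', p, h3, h4, existsUnique_of_not_spoke hring he h5 ?_ ?_,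
    existsUnique_of_not_spoke hring he h6 ?_ ?_, existsUnique_of_not_spoke hring he h7 ?_ ?_, ?_⟩
  · grind
  · grind
  · grind
  · grind
  · grind
  · grind
  · rintro x ⟨d, hd, hxd⟩
    exact h10 x (Walk.mem_support_of_mem_edges ((hq' _).2 hd) hxd)

theorem not_spoke_subset_support (hF : IsFullerene G faces)
    (hring : IsPentagonalRing faces 5 ring) (hbd : AreBoundaryCycles 5 ring c c')
    {e : ZMod 5 → Sym2 V} (he : ∀ i, ring i ∩ ring (i + 1) = {e i}) (i : ZMod 5) :
    ¬ ∀ v ∈ e i, v ∈ c.support := by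
  intro h
  have step : ∀ i, (∀ v ∈ e (i - 1), v ∈ c.support) →
      (∀ v ∈ e i, v ∈ c.support) ∧ ∀ v ∈ faceVerts (ring i), v ∈ c.support := by
    intro i hi
    obtain ⟨a, b, a', b', p, h1, h2, h3, h4, h5, h6⟩ :=
      exists_ring_face_labelling hF hring he i
    have ha := hi a (by simp [h1])
    have hb := hi b (by simp [h1])
    have hb' := (mem_support_of_existsUnique hbd h3 hb).2
    rw [Sym2.eq_swap] at h4 h5
    have hp := (mem_support_of_existsUnique hbd h5 ha).2
    have ha' := (mem_support_of_existsUnique hbd h4 hp).2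
    refine ⟨by simp [h2, ha', hb'], fun v hv => ?_⟩
    rcases h6 v hv with rfl | rfl | rfl | rfl | rfl <;> assumption
  have all : ∀ n : ℕ, ∀ v ∈ e (i + n), v ∈ c.support := by
    intro n
    induction n with
    | zero => simpa using h
    | succ n ih =>
      refine (step _ ?_).1
      rwa [Nat.cast_succ, ← add_assoc, add_sub_cancel_right]
  obtain ⟨j, hj⟩ := (hbd.2.2.2.1 w).1 (Or.inr c'.start_mem_support)
  refine hbd.2.2.1 w ((step j ?_).2 w hj) c'.start_mem_support
  have := all (j - 1 - i).val
  rwa [ZMod.natCast_zmod_val, add_sub_cancel] at this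

theorem exists_ring_labelling (hF : IsFullerene G faces)
    (hring : IsPentagonalRing faces 5 ring) (hbd : AreBoundaryCycles 5 ring c c') :
    ∃ x y p : ZMod 5 → V, (∀ i, ring i ∩ ring (i + 1) = {s(x i, y i)}) ∧
      (∀ i, x i ∈ c.support) ∧ (∀ i, y i ∈ c'.support) ∧
      ∀ i, ∀ v ∈ faceVerts (ring i), (∃ j, v = x j) ∨ (∃ j, v = y j) ∨ v = p i := by
  choose e he using hring.2.2.2.1
  have hxy : ∀ i, ∃ x y, e i = s(x, y) ∧ x ∈ c.support ∧ y ∈ c'.support := by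
    intro i
    have h1 := not_spoke_subset_support hF hring hbd he i
    have h2 := not_spoke_subset_support hF hring hbd.symm he i
    have hi : e i ∈ ring i := by
      have : e i ∈ ring i ∩ ring (i + 1) := by rw [he]; simp
      exact (Finset.mem_inter.1 this).1
    generalize e i = d at *
    induction d with | _ a b =>
    have ha := (hbd.2.2.2.1 a).2 ⟨i, mem_faceVerts_left hi⟩
    have hb := (hbd.2.2.2.1 b).2 ⟨i, mem_faceVerts_right hi⟩
    simp only [Sym2.mem_iff, forall_eq_or_imp, forall_eq] at h1 h2
    rcases ha with ha | ha <;> rcases hb with hb | hb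
    · exact absurd ⟨ha, hb⟩ h1
    · exact ⟨a, b, rfl, ha, hb⟩
    · exact ⟨b, a, Sym2.eq_swap, hb, ha⟩
    · exact absurd ⟨ha, hb⟩ h2
  choose x y hxy hx hy using hxy
  have hp : ∀ i, ∃ p, ∀ v ∈ faceVerts (ring i), (∃ j, v = x j) ∨ (∃ j, v = y j) ∨ v = p := by
    intro i
    obtain ⟨a, b, a', b', p, h1, h2, -, -, -, h6⟩ := exists_ring_face_labelling hF hring he i
    have hs : ∀ j, ∀ v ∈ e j, (∃ j, v = x j) ∨ (∃ j, v = y j) := by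
      intro j v hv
      rw [hxy, Sym2.mem_iff] at hv
      exact hv.imp (fun h => ⟨j, h⟩) (fun h => ⟨j, h⟩)
    refine ⟨p, fun v hv => ?_⟩
    rw [← or_assoc]
    rcases h6 v hv with rfl | rfl | rfl | rfl | rfl
    · exact Or.inl (hs (i - 1) _ (by simp [h1]))
    · exact Or.inl (hs (i - 1) _ (by simp [h1]))
    · exact Or.inl (hs i _ (by simp [h2]))
    · exact Or.inl (hs i _ (by simp [h2]))
    · exact Or.inr rfl
  choose p hp using hp
  exact ⟨x, y, p, fun i => by rw [he, hxy], hx, hy, hp⟩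

/-- A boundary cycle of the ring that has at most two vertices off the spokes bounds a face. -/
theorem exists_face_of_boundary_cycle (hF : IsFullerene G faces)
    (hring : IsPentagonalRing faces 5 ring) (hbd : AreBoundaryCycles 5 ring c c')
    {x y p : ZMod 5 → V} (hxy : ∀ i, ring i ∩ ring (i + 1) = {s(x i, y i)})
    (hx : ∀ i, x i ∈ c.support) (hy : ∀ i, y i ∈ c'.support)
    (hp : ∀ i, ∀ v ∈ faceVerts (ring i), (∃ j, v = x j) ∨ (∃ j, v = y j) ∨ v = p i)
    (hk : (Finset.univ.filter fun i => p i ∈ c.support).card ≤ 2) :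
    ∃ f ∈ faces, f.card = 5 ∧ f = c.edges.toFinset := by
  set C := c.edges.toFinset with hCdef
  have hCG : ∀ e ∈ C, e ∈ G.edgeSet := fun e he =>
    c.edges_subset_edgeSet (List.mem_toFinset.1 he)
  have hC2 : ∀ v ∈ c.support, (nbrsIn C v).card = 2 := fun v => card_nbrsIn_of_isCycle hbd.1
  have hCl : ∀ a b, s(a, b) ∈ C → a ∈ c.support := fun a b h =>
    c.fst_mem_support_of_mem_edges (List.mem_toFinset.1 h)
  have hy' : ∀ i, y i ∉ c.support := fun i h => hbd.2.2.1 _ h (hy i)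
  have hspoke : ∀ i, s(x i, y i) ∈ ring i ∧ s(x i, y i) ∈ ring (i + 1) := fun i => by
    rw [← Finset.mem_inter, hxy]; simp
  have hspokeC : ∀ i, s(x i, y i) ∉ C := fun i h => by
    rw [Sym2.eq_swap] at h
    exact hy' i (hCl _ _ h)
  have hringF : ∀ i, ring i ∈ faces := fun i => (hring.2.2.1 i).1
  have hadj : ∀ f ∈ faces, ∀ a b, s(a, b) ∈ f → G.Adj a b := fun f hf a b h =>
    face_subset_edgeSet hF hf h
  obtain ⟨t, ht, ht0⟩ : ∃ t : Finset (Sym2 V) → ZMod 2, (∀ f ∈ faces, ∀ g ∈ faces, f ≠ g →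
      ∀ e ∈ f, e ∈ g → t f + t g = if e ∈ C then 1 else 0) ∧ t (ring 0) = 0 := by
    obtain ⟨t, ht⟩ := exists_side hF hCG (fun v ⟨e, he, hv⟩ =>
      hC2 v (Walk.mem_support_of_mem_edges (List.mem_toFinset.1 he) hv))
    refine ⟨fun f => t f + t (ring 0), fun f hf g hg hfg e hef heg => ?_,
      CharTwo.add_self_eq_zero _⟩
    rw [← ht f hf g hg hfg e hef heg, add_add_add_comm, CharTwo.add_self_eq_zero, add_zero]
  have hsame : ∀ f ∈ faces, ∀ g ∈ faces, ∀ e ∈ f, e ∈ g → e ∉ C → t f = t g := by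
    intro f hf g hg e hef heg heC
    by_cases hfg : f = g
    · rw [hfg]
    · have := ht f hf g hg hfg e hef heg
      rw [if_neg heC] at this
      exact CharTwo.add_eq_zero.1 this
  have hring0 : ∀ i, t (ring i) = 0 := by
    have : ∀ n : ℕ, t (ring n) = 0 := by
      intro n
      induction n with
      | zero => simpa using ht0
      | succ n ih =>
        rw [← ih, Nat.cast_succ]
        exact (hsame _ (hringF _) _ (hringF _) _ (hspoke n).1 (hspoke n).2 (hspokeC n)).symm
    intro i
    simpa using this i.val
  have hin : ∀ g ∈ faces, ∀ e ∈ g, e ∈ C → (∀ i, g ≠ ring i) → t g = 1 := by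
    intro g hg e heg heC hgr
    obtain ⟨i, hi, -⟩ := (hbd.2.2.2.2 e).1 (Or.inl (List.mem_toFinset.1 heC))
    have := ht g hg _ (hringF i) (hgr i) e heg hi
    rwa [if_pos heC, hring0, add_zero] at this
  let P : Finset V := c.support.toFinset \ Finset.univ.image x
  have hPmem : ∀ v, v ∈ P ↔ v ∈ c.support ∧ ∀ i, x i ≠ v := fun v => by simp [P]
  have hPcard : P.card ≤ 2 := by
    refine le_trans (Finset.card_le_card ?_) (le_trans (Finset.card_image_le (f := p)) hk)
    intro v hv
    obtain ⟨hv, hvx⟩ := (hPmem v).1 hv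
    obtain ⟨i, hi⟩ := (hbd.2.2.2.1 v).1 (Or.inl hv)
    rcases hp i v hi with ⟨j, rfl⟩ | ⟨j, rfl⟩ | rfl
    · exact absurd rfl (hvx j)
    · exact absurd hv (hy' j)
    · exact Finset.mem_image.2 ⟨i, by simpa using hv, rfl⟩
  have hCcard : C.card ≤ 5 + P.card := by
    refine (card_edges_le_card_support hbd.1).trans ?_
    have : c.support.toFinset ⊆ Finset.univ.image x ∪ P := by simp [P]
    refine (Finset.card_le_card this).trans ((Finset.card_union_le _ _).trans ?_)
    have : (Finset.univ.image x).card ≤ 5 := Finset.card_image_le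
    omega
  have hxedge : ∀ i v, G.Adj (x i) v → s(x i, v) ∉ C → v = y i := fun i v hv hvC =>
    eq_of_not_mem hF.cubic hCG (hC2 _ (hx i)) hv (hadj _ (hringF i) _ _ (hspoke i).1) hvC
      (hspokeC i)
  have hoff : ∀ v ∉ c.support, ∀ f ∈ faces, ∀ g ∈ faces, v ∈ faceVerts f → v ∈ faceVerts g →
      t f = t g := by
    intro v hv f hf g hg hvf hvg
    obtain ⟨w, h1, h2⟩ := exists_shared_edge hF hf hg hvf hvg
    exact hsame f hf g hg _ h1 h2 fun h => hv (hCl _ _ h)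
  -- Three-connectedness: the inner faces have no vertices off the cycle.
  have hinner : ∀ f ∈ faces, t f = 1 → ∀ v ∈ faceVerts f, v ∈ c.support := by
    intro f hf hft v hv
    by_contra hvc
    have hnotP : ∀ v ∉ c.support, v ∉ (P : Set V) := fun v hv h => hv ((hPmem v).1 h).1
    have : y 0 ∈ {v | v ∉ c.support ∧ ∃ f ∈ faces, t f = 1 ∧ v ∈ faceVerts f} := by
      refine mem_of_closed_of_connected (P := P)
        (hF.threeConnected P (by rwa [Set.ncard_coe_finset])) ?_ (a := v) ⟨hvc, f, hf, hft, hv⟩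
        (hnotP v hvc) (hnotP _ (hy' 0))
      rintro v ⟨hvc, f, hf, hft, hv⟩ - w hvw
      obtain ⟨g, hg, -, -, -, heg, -⟩ := exists_two_faces hF (e := s(v, w)) hvw
      have hgt : t g = 1 := (hoff v hvc g hg f hf (mem_faceVerts_left heg) hv).trans hft
      by_cases hw : w ∈ c.support
      · right
        refine (hPmem w).2 ⟨hw, ?_⟩
        rintro i rfl
        obtain rfl := hxedge i v hvw.symm fun h => hvc (hCl _ _ (Sym2.eq_swap ▸ h))
        have := hoff (y i) hvc g hg _ (hringF i) (mem_faceVerts_left heg)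
          (mem_faceVerts_right (hspoke i).1)
        rw [hgt, hring0] at this
        exact one_ne_zero this
      · exact Or.inl ⟨hw, g, hg, hgt, mem_faceVerts_right heg⟩
    obtain ⟨-, f, hf, hft, hyf⟩ := this
    have := hoff _ (hy' 0) f hf _ (hringF 0) hyf (mem_faceVerts_right (hspoke 0).1)
    rw [hft, hring0] at this
    exact one_ne_zero this
  have hchord : ∀ f ∈ faces, t f = 1 → ∀ a b, s(a, b) ∈ f → s(a, b) ∉ C → a ∈ P := by
    intro f hf hft a b hab habC
    refine (hPmem a).2 ⟨hinner f hf hft a (mem_faceVerts_left hab), ?_⟩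
    rintro i rfl
    obtain rfl := hxedge i b (hadj f hf _ _ hab) habC
    exact hy' i (hinner f hf hft _ (mem_faceVerts_right hab))
  rcases P.eq_empty_or_nonempty with hP | ⟨q, hq⟩
  · obtain ⟨w, hw⟩ : (nbrsIn C u).Nonempty := by
      rw [← Finset.card_pos, hC2 u c.start_mem_support]; norm_num
    have hw := mem_nbrsIn.1 hw
    obtain ⟨g, hg, hgt⟩ : ∃ g ∈ faces, t g = 1 := by
      obtain ⟨f, hf, g, hg, hfg, hef, heg⟩ := exists_two_faces hF (hCG _ hw)
      have h := ht f hf g hg hfg _ hef heg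
      rw [if_pos hw] at h
      by_cases hft : t f = 1
      · exact ⟨f, hf, hft⟩
      · refine ⟨g, hg, ?_⟩
        generalize t f = r at *
        generalize t g = s at *
        revert r s
        decide
    have hsub : g ⊆ C := by
      intro e he
      by_contra heC
      induction e with | _ a b =>
      have := hchord g hg hgt a b he heC
      simp [hP] at this
    have h5 : 5 ≤ g.card := by rcases hF.face_size g hg with h | h <;> omega
    rw [hP, Finset.card_empty] at hCcard
    have := Finset.card_le_card hsub
    exact ⟨g, hg, by omega, Finset.eq_of_subset_of_card_le hsub (by omega)⟩
  · exfalso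
    obtain ⟨hqc, hqx⟩ := (hPmem q).1 hq
    obtain ⟨r, hqr, hqrC⟩ := exists_not_mem hF.cubic (hC2 q hqc)
    obtain ⟨f, hf, g, hg, hfg, hef, heg⟩ := exists_two_faces hF (e := s(q, r)) hqr
    have hnotring : ∀ i, s(q, r) ∉ ring i := by
      intro i hi
      have hne : ∀ j, s(q, r) ≠ s(x j, y j) := by
        intro j h
        rcases Sym2.eq_iff.1 h with h | h
        · exact hqx j h.1.symm
        · exact hy' j (h.1 ▸ hqc)
      have := existsUnique_of_not_spoke hring hxy hi (hne _) (hne _)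
      exact hqrC (List.mem_toFinset.2 (mem_support_of_existsUnique hbd this hqc).1)
    have hside : ∀ h ∈ faces, s(q, r) ∈ h → t h = 1 := by
      intro h hh hqh
      obtain ⟨z, hz1, hz2⟩ := exists_common_edge hF.cubic (fun _ => face_subset_edgeSet hF hh) hCG
        (card_nbrsIn_of_mem_faceVerts hF hh (mem_faceVerts_left hqh)) (hC2 q hqc)
      exact hin h hh _ hz1 hz2 fun i hi => hnotring i (hi ▸ hqh)
    have hft := hside f hf hef
    have hgt := hside g hg heg
    have hr : r ∈ P := hchord f hf hft r q (Sym2.eq_swap ▸ hef) (Sym2.eq_swap ▸ hqrC)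
    have hP : P = {q, r} := by
      symm
      refine Finset.eq_of_subset_of_card_le ?_ (by rwa [Finset.card_pair hqr.ne])
      intro v hv
      simp only [Finset.mem_insert, Finset.mem_singleton] at hv
      rcases hv with rfl | rfl <;> assumption
    have herase : ∀ h ∈ faces, t h = 1 → h.erase s(q, r) ⊆ C := by
      intro h hh hht e he
      obtain ⟨hne, he⟩ := Finset.mem_erase.1 he
      by_contra heC
      induction e with | _ a b =>
      have ha := hchord h hh hht a b he heC
      have hb := hchord h hh hht b a (Sym2.eq_swap ▸ he) (Sym2.eq_swap ▸ heC)
      have hab := (hadj h hh a b he).ne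
      simp only [hP, Finset.mem_insert, Finset.mem_singleton] at ha hb
      rcases ha with rfl | rfl <;> rcases hb with rfl | rfl
      · exact hab rfl
      · exact hne rfl
      · exact hne Sym2.eq_swap
      · exact hab rfl
    have hdisj : Disjoint (f.erase s(q, r)) (g.erase s(q, r)) := by
      rw [Finset.disjoint_left]
      intro e he he'
      have := ht f hf g hg hfg e (Finset.mem_of_mem_erase he) (Finset.mem_of_mem_erase he')
      rw [if_pos (herase f hf hft he), hft, hgt] at this
      exact absurd this (by decide)
    have hle := Finset.card_le_card
      (Finset.union_subset (herase f hf hft) (herase g hg hgt))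
    rw [Finset.card_union_of_disjoint hdisj, Finset.card_erase_of_mem hef,
      Finset.card_erase_of_mem heg] at hle
    rcases hF.face_size f hf with h1 | h1 <;> rcases hF.face_size g hg with h2 | h2 <;> omega

end Helpers

/-- a pentagonal ring of length five in a fullerene graph is the
configuration `R₅`: its inner or outer cycle bounds a pentagonal face. -/
theorem pentagonal_ring_five_is_R5 {V : Type*} [Fintype V] [DecidableEq V]
    (G : SimpleGraph V) (faces : Finset (Finset (Sym2 V)))
    (hF : IsFullerene G faces)
    (ring : ZMod 5 → Finset (Sym2 V)) (hring : IsPentagonalRing faces 5 ring)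
    (u w : V) (c : G.Walk u u) (c' : G.Walk w w)
    (hbd : AreBoundaryCycles 5 ring c c') :
    ∃ f ∈ faces, f.card = 5 ∧ (f = c.edges.toFinset ∨ f = c'.edges.toFinset) := by
  obtain ⟨x, y, p, hxy, hx, hy, hp⟩ := exists_ring_labelling hF hring hbd
  by_cases hk : (Finset.univ.filter fun i => p i ∈ c.support).card ≤ 2
  · obtain ⟨f, hf, hf5, hfc⟩ := exists_face_of_boundary_cycle hF hring hbd hxy hx hy hp hk
    exact ⟨f, hf, hf5, Or.inl hfc⟩
  · have hk' : (Finset.univ.filter fun i => p i ∈ c'.support).card ≤ 2 := by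
      have hdisj : Disjoint (Finset.univ.filter fun i => p i ∈ c.support)
          (Finset.univ.filter fun i => p i ∈ c'.support) := by
        rw [Finset.disjoint_filter]
        exact fun i _ h => hbd.2.2.1 _ h
      have h := Finset.card_le_univ ((Finset.univ.filter fun i => p i ∈ c.support) ∪
        (Finset.univ.filter fun i => p i ∈ c'.support))
      rw [Finset.card_union_of_disjoint hdisj, ZMod.card] at h
      omega
    obtain ⟨f, hf, hf5, hfc⟩ := exists_face_of_boundary_cycle hF hring hbd.symm
      (x := y) (y := x) (fun i => by rw [hxy, Sym2.eq_swap]) hy hx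
      (fun i v hv => or_left_comm.1 (hp i v hv)) hk'
    exact ⟨f, hf, hf5, Or.inr hfc⟩
end
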